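/- In the setting below, suppose ℓ(λ) + 1 ≤ r ≤ N is such that μ_{r−1} > μ_r (so in particular μ_r is finite; here μ_0 := ∞), and let m := #{j : μ_j = μ_r} be the multiplicity of μ_r in μ. Set C := (t^{r−ℓ(λ)} − t^r)·((1 − t^m)/(1 − t))·((t;t)_{r−1}·(t;t)_{N−ℓ(λ)}) / ((t;t)_N·(t;t)_{r−ℓ(λ)}). Then (1 − t^{r−ℓ(λ)})·C ≤ Pr(ν_r = μ_r + 1 and ν_j = μ_j for all j > r) ≤ C. -/

import Mathlib

/-!
Statement 11 (Lemma `single_box`): with `A` Haar-distributed on `GL_N(ℤ_p)`,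
`ν := SN(diag(p^λ)·A·diag(p^μ))`, `ℓ(λ)+1 ≤ r ≤ N` with `μ_{r−1} > μ_r` (here `μ_0 := ∞`),
and `m` the multiplicity of `μ_r` in `μ`, setting
`C := (t^{r−ℓ(λ)} − t^r)·((1−t^m)/(1−t))·((t;t)_{r−1}(t;t)_{N−ℓ(λ)})/((t;t)_N (t;t)_{r−ℓ(λ)})`,
one has `(1 − t^{r−ℓ(λ)})·C ≤ Pr(ν_r = μ_r + 1 and ν_j = μ_j for all j > r) ≤ C`.
The Haar probability measure on `GL_N(ℤ_p)` is encoded as a left-invariant probability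
measure on `Mat_N(ℤ_p)` concentrated on the invertible matrices.
-/

open MeasureTheory

noncomputable section

instance padicMS (p : ℕ) [Fact p.Prime] : MeasurableSpace ℤ_[p] := borel _

instance matrixMS (p N : ℕ) [Fact p.Prime] :
    MeasurableSpace (Matrix (Fin N) (Fin N) ℤ_[p]) :=
  inferInstanceAs (MeasurableSpace (Fin N → Fin N → ℤ_[p]))

/-- `p^a ∈ ℤ_p` for `a ∈ ℕ ∪ {∞}`, with the convention `p^∞ = 0`. -/
def zppow (p : ℕ) [Fact p.Prime] (a : WithTop ℕ) : ℤ_[p] :=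
  if h : a = ⊤ then 0 else (p : ℤ_[p]) ^ (a.untop h)

/-- The diagonal matrix `diag(p^{s₁},…,p^{s_N})` over `ℤ_p`. -/
def snDiag (p : ℕ) [Fact p.Prime] (N : ℕ) (s : Fin N → WithTop ℕ) :
    Matrix (Fin N) (Fin N) ℤ_[p] :=
  Matrix.diagonal fun i => zppow p (s i)

/-- `s` is the (weakly decreasing) tuple of singular numbers of `A ∈ Mat_N(ℤ_p)`. -/
def IsSN (p : ℕ) [Fact p.Prime] (N : ℕ) (A : Matrix (Fin N) (Fin N) ℤ_[p])
    (s : Fin N → WithTop ℕ) : Prop :=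
  Antitone s ∧ ∃ U V : (Matrix (Fin N) (Fin N) ℤ_[p])ˣ, A = U.val * snDiag p N s * V.val

/-- The `t`-Pochhammer symbol `(t;t)_n = ∏_{i=1}^n (1 - tⁱ)`. -/
def tPoch (t : ℝ) (n : ℕ) : ℝ := ∏ i ∈ Finset.range n, (1 - t ^ (i + 1))

section SmithNormalForm

variable (p : ℕ) [Fact p.Prime]

lemma zppow_top : zppow p ⊤ = 0 := by simp [zppow]

lemma zppow_natCast (n : ℕ) : zppow p (n : WithTop ℕ) = (p : ℤ_[p]) ^ n := by
  rw [zppow, dif_neg (WithTop.natCast_ne_top n)]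
  rfl

lemma zppow_zero : zppow p 0 = 1 := by
  simpa using zppow_natCast p 0

lemma eq_top_or_eq_natCast (a : WithTop ℕ) : a = ⊤ ∨ ∃ n : ℕ, a = (n : WithTop ℕ) := by
  induction a using WithTop.recTopCoe with
  | top => exact Or.inl rfl
  | coe a => exact Or.inr ⟨a, rfl⟩

lemma zppow_add_natCast (a : WithTop ℕ) (c : ℕ) :
    zppow p (a + c) = (p : ℤ_[p]) ^ c * zppow p a := by
  obtain rfl | ⟨a, rfl⟩ := eq_top_or_eq_natCast a
  · simp [zppow_top]
  · rw [← Nat.cast_add, zppow_natCast, zppow_natCast, pow_add, mul_comm]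

variable {p}

lemma pow_dvd_zppow {c : ℕ} {a : WithTop ℕ} (h : (c : WithTop ℕ) ≤ a) :
    (p : ℤ_[p]) ^ c ∣ zppow p a := by
  obtain rfl | ⟨a, rfl⟩ := eq_top_or_eq_natCast a
  · simp [zppow_top]
  · rw [zppow_natCast]
    exact pow_dvd_pow _ (by exact_mod_cast h)

lemma natCast_p_ne_zero : (p : ℤ_[p]) ≠ 0 := by
  exact_mod_cast (Fact.out : p.Prime).ne_zero

lemma exists_zppow_eq {c : ℕ} {a : WithTop ℕ} (h : ¬ ((c + 1 : ℕ) : WithTop ℕ) ≤ a) :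
    ∃ e ≤ c, a = (e : ℕ) ∧ zppow p a = (p : ℤ_[p]) ^ e := by
  obtain rfl | ⟨a, rfl⟩ := eq_top_or_eq_natCast a
  · simp at h
  · refine ⟨a, ?_, rfl, zppow_natCast p a⟩
    have : ¬ (c + 1 ≤ a) := fun h' => h (by exact_mod_cast h')
    omega

lemma dvd_of_pow_dvd_zppow_mul {c : ℕ} {a : WithTop ℕ} {x : ℤ_[p]}
    (h : ¬ ((c + 1 : ℕ) : WithTop ℕ) ≤ a) (hx : (p : ℤ_[p]) ^ (c + 1) ∣ zppow p a * x) :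
    (p : ℤ_[p]) ∣ x := by
  obtain ⟨e, he, -, h'⟩ := exists_zppow_eq (p := p) h
  rw [h'] at hx
  have h1 : (p : ℤ_[p]) ^ (e + 1) ∣ (p : ℤ_[p]) ^ e * x := (pow_dvd_pow _ (by omega)).trans hx
  rw [pow_succ] at h1
  exact (mul_dvd_mul_iff_left (pow_ne_zero _ natCast_p_ne_zero)).1 h1

lemma toZMod_eq_zero_iff {x : ℤ_[p]} : PadicInt.toZMod x = 0 ↔ (p : ℤ_[p]) ∣ x := by
  rw [← RingHom.mem_ker, PadicInt.ker_toZMod, PadicInt.maximalIdeal_eq_span_p,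
    Ideal.mem_span_singleton]

lemma isUnit_iff_toZMod_ne_zero {x : ℤ_[p]} : IsUnit x ↔ PadicInt.toZMod x ≠ 0 := by
  rw [← not_iff_not, not_not, ← RingHom.mem_ker, PadicInt.ker_toZMod,
    IsLocalRing.mem_maximalIdeal, mem_nonunits_iff]

/-- A nonzero matrix over `ℤ_p` is a power of `p` times a matrix with a unit entry. -/
lemma exists_eq_pow_smul_of_ne_zero {ι κ : Type*} (M : Matrix ι κ ℤ_[p]) (hM : M ≠ 0) :
    ∃ (c : ℕ) (M' : Matrix ι κ ℤ_[p]) (i : ι) (j : κ),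
      M = (p : ℤ_[p]) ^ c • M' ∧ IsUnit (M' i j) := by
  classical
  have hex : ∃ c : ℕ, ∃ i j, ¬ (p : ℤ_[p]) ^ (c + 1) ∣ M i j := by
    obtain ⟨i, j, hij⟩ : ∃ i j, M i j ≠ 0 := by
      by_contra! h
      exact hM (by ext i j; simp [h i j])
    have hfin : FiniteMultiplicity (p : ℤ_[p]) (M i j) :=
      FiniteMultiplicity.of_prime_left PadicInt.prime_p hij
    obtain ⟨n, hn⟩ := hfin
    exact ⟨n, i, j, hn⟩
  have hdvd : ∀ i j, (p : ℤ_[p]) ^ Nat.find hex ∣ M i j := by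
    intro i j
    rcases h : Nat.find hex with _ | c
    · simp
    · by_contra hc
      exact Nat.find_min hex (m := c) (by omega) ⟨i, j, hc⟩
  obtain ⟨i, j, hij⟩ := Nat.find_spec hex
  choose M' hM' using hdvd
  refine ⟨Nat.find hex, Matrix.of M', i, j, by ext i j; simp [hM' i j], ?_⟩
  rw [isUnit_iff_toZMod_ne_zero, Ne, toZMod_eq_zero_iff]
  intro h
  apply hij
  rw [hM' i j, pow_succ]
  exact mul_dvd_mul_left _ h

lemma isSN_of_isUnit {N : ℕ} {M U V : Matrix (Fin N) (Fin N) ℤ_[p]} {s : Fin N → WithTop ℕ}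
    (hs : Antitone s) (hU : IsUnit U) (hV : IsUnit V) (h : M = U * snDiag p N s * V) :
    IsSN p N M s :=
  ⟨hs, hU.unit, hV.unit, h⟩

lemma isSN_pow_smul {N : ℕ} {M : Matrix (Fin N) (Fin N) ℤ_[p]} {s : Fin N → WithTop ℕ}
    (h : IsSN p N M s) (c : ℕ) :
    IsSN p N ((p : ℤ_[p]) ^ c • M) (fun i => s i + c) := by
  obtain ⟨hs, U, V, h⟩ := h
  refine ⟨fun i j hij => add_le_add_left (hs hij) _, U, V, ?_⟩
  have : snDiag p N (fun i => s i + c) = (p : ℤ_[p]) ^ c • snDiag p N s := by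
    ext i j
    simp [snDiag, Matrix.diagonal_apply, zppow_add_natCast]
  rw [this, h]
  simp

/-- A square matrix over `ℤ_p` has singular numbers. -/
theorem exists_isSN (N : ℕ) (M : Matrix (Fin N) (Fin N) ℤ_[p]) : ∃ s, IsSN p N M s := by
  induction N with
  | zero =>
    exact ⟨fun _ => 0, fun _ _ _ => le_rfl, 1, 1, by ext i; exact i.elim0⟩
  | succ N ih =>
    by_cases hM : M = 0
    · refine ⟨fun _ => ⊤, fun _ _ _ => le_rfl, 1, 1, ?_⟩
      ext i j
      simp [hM, snDiag, zppow_top]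
    obtain ⟨c, M', i, j, rfl, hu⟩ := exists_eq_pow_smul_of_ne_zero M hM
    suffices h : ∃ s, IsSN p (N + 1) M' s by
      obtain ⟨s, hs⟩ := h
      exact ⟨_, isSN_pow_smul hs c⟩
    let e₀ : Fin N ⊕ Fin 1 ≃ Fin (N + 1) := finSumFinEquiv
    let e₁ := e₀.trans (Equiv.swap (Fin.last N) i)
    let e₂ := e₀.trans (Equiv.swap (Fin.last N) j)
    have he₀ : e₀ (Sum.inr 0) = Fin.last N := by ext; simp [e₀]
    have he₁ : e₁ (Sum.inr 0) = i := by simp [e₁, he₀]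
    have he₂ : e₂ (Sum.inr 0) = j := by simp [e₂, he₀]
    let B := M'.submatrix e₁ e₂
    have hD : IsUnit B.toBlocks₂₂ := by
      rw [Matrix.isUnit_iff_isUnit_det, Matrix.det_unique]
      simpa [B, Matrix.toBlocks₂₂, he₁, he₂] using hu
    let _ := hD.invertible
    obtain ⟨s, hs, U, V, hUV⟩ :=
      ih (B.toBlocks₁₁ - B.toBlocks₁₂ * ⅟B.toBlocks₂₂ * B.toBlocks₂₁)
    have hB := Matrix.fromBlocks_eq_of_invertible₂₂ B.toBlocks₁₁ B.toBlocks₁₂ B.toBlocks₂₁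
      B.toBlocks₂₂
    rw [Matrix.fromBlocks_toBlocks, hUV] at hB
    set s' : Fin (N + 1) → WithTop ℕ := fun k => Sum.elim s (fun _ => 0) (e₀.symm k) with hs'
    have hdiag : (snDiag p (N + 1) s').submatrix e₀ e₀ =
        Matrix.fromBlocks (snDiag p N s) 0 0 (1 : Matrix (Fin 1) (Fin 1) ℤ_[p]) := by
      ext a b
      rcases a with a | a <;> rcases b with b | b <;>
        simp [snDiag, Matrix.diagonal_apply, hs', zppow_zero, Matrix.one_apply]
    have hmid : Matrix.fromBlocks (U.val * snDiag p N s * V.val) 0 0 B.toBlocks₂₂ =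
        Matrix.fromBlocks U.val 0 0 B.toBlocks₂₂ * (snDiag p (N + 1) s').submatrix e₀ e₀ *
          Matrix.fromBlocks V.val 0 0 (1 : Matrix (Fin 1) (Fin 1) ℤ_[p]) := by
      simp [hdiag, Matrix.fromBlocks_multiply]
    set L := Matrix.fromBlocks 1 (B.toBlocks₁₂ * ⅟B.toBlocks₂₂) 0 1 *
      Matrix.fromBlocks U.val 0 0 B.toBlocks₂₂ with hL
    set R := Matrix.fromBlocks V.val 0 0 (1 : Matrix (Fin 1) (Fin 1) ℤ_[p]) *
      Matrix.fromBlocks 1 0 (⅟B.toBlocks₂₂ * B.toBlocks₂₁) 1 with hR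
    have hLu : IsUnit L := by
      refine IsUnit.mul ?_ ?_
      · rw [Matrix.isUnit_fromBlocks_zero₂₁]; simp
      · rw [Matrix.isUnit_fromBlocks_zero₂₁]; simp [hD]
    have hRu : IsUnit R := by
      refine IsUnit.mul ?_ ?_
      · rw [Matrix.isUnit_fromBlocks_zero₂₁]; simp
      · rw [Matrix.isUnit_fromBlocks_zero₁₂]; simp
    have hB' : B = L * (snDiag p (N + 1) s').submatrix e₀ e₀ * R := by
      rw [hB, hmid, hL, hR]
      simp only [Matrix.mul_assoc]
    have hM' : M' = L.submatrix e₁.symm e₀.symm * snDiag p (N + 1) s' *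
        R.submatrix e₀.symm e₂.symm := by
      have h1 : M' = B.submatrix e₁.symm e₂.symm := by ext; simp [B]
      rw [h1, hB', Matrix.submatrix_mul_equiv _ _ _ e₀.symm _ |>.symm,
        Matrix.submatrix_mul_equiv _ _ _ e₀.symm _ |>.symm]
      simp
    refine ⟨s', isSN_of_isUnit ?_ ?_ ?_ hM'⟩
    · intro a b hab
      obtain ⟨a, rfl⟩ := e₀.surjective a
      obtain ⟨b, rfl⟩ := e₀.surjective b
      rcases a with a | a <;> rcases b with b | b
      · have : a ≤ b := by
          rw [Fin.le_def] at hab ⊢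
          simpa [e₀] using hab
        simpa [hs'] using hs this
      · simp [hs']
      · have : (N + (a : ℕ)) ≤ b := by simpa [e₀, Fin.le_def] using hab
        omega
      · simp [hs']
    · simpa using hLu
    · simpa using hRu

end SmithNormalForm

section CoordinateSubspace

variable {ι : Type*} (K : Type*) [Field K]

/-- The vectors supported on the coordinates satisfying `P`. -/
def supportedOn (P : ι → Prop) : Submodule K (ι → K) where
  carrier := {z | ∀ j, ¬ P j → z j = 0}
  add_mem' := fun ha hb j hj => by simp [ha j hj, hb j hj]
  zero_mem' := fun _ _ => rfl
  smul_mem' := fun c a ha j hj => by simp [ha j hj]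

variable {K}

lemma mem_supportedOn {P : ι → Prop} {z : ι → K} :
    z ∈ supportedOn K P ↔ ∀ j, ¬ P j → z j = 0 := Iff.rfl

lemma supportedOn_mono {P Q : ι → Prop} (h : ∀ j, P j → Q j) :
    supportedOn K P ≤ supportedOn K Q :=
  fun _ hz j hj => hz j fun hP => hj (h j hP)

lemma finrank_supportedOn [Fintype ι] (P : ι → Prop) [DecidablePred P] :
    Module.finrank K (supportedOn K P) = (Finset.univ.filter P).card := by
  let e : supportedOn K P ≃ₗ[K] ({j // P j} → K) :=
    { toFun := fun z j => z.1 j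
      invFun := fun w => ⟨fun j => if h : P j then w ⟨j, h⟩ else 0, fun j hj => by simp [hj]⟩
      map_add' := fun _ _ => rfl
      map_smul' := fun _ _ => rfl
      left_inv := fun z => by
        ext j
        by_cases h : P j
        · simp [h]
        · simp [h, z.2 j h]
      right_inv := fun w => by
        ext j
        simp [j.2] }
  rw [e.finrank_eq, Module.finrank_fintype_fun_eq_card, Fintype.card_subtype]

end CoordinateSubspace

section DivisibilityKernel

variable {p : ℕ} [Fact p.Prime] {ι : Type*}

/-- The standard lift of a vector over `𝔽_p` to `ℤ_p`. -/
def liftVec (z : ι → ZMod p) : ι → ℤ_[p] := fun j => ((z j).val : ℤ_[p])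

@[simp] lemma toZMod_liftVec (z : ι → ZMod p) (j : ι) : PadicInt.toZMod (liftVec z j) = z j := by
  simp [liftVec]

lemma liftVec_eq_zero {z : ι → ZMod p} {j : ι} (h : z j = 0) : liftVec z j = 0 := by
  simp [liftVec, h]

variable [Fintype ι]

lemma dvd_mulVec {d : ℤ_[p]} {x : ι → ℤ_[p]} (h : ∀ j, d ∣ x j) {κ : Type*}
    (A : Matrix κ ι ℤ_[p]) (i : κ) : d ∣ A.mulVec x i :=
  Finset.dvd_sum fun j _ => (h j).mul_left _

lemma toZMod_mulVec {κ : Type*} (A : Matrix κ ι ℤ_[p]) (x : ι → ℤ_[p]) (i : κ) :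
    PadicInt.toZMod (A.mulVec x i) =
      (A.map PadicInt.toZMod).mulVec (fun j => PadicInt.toZMod (x j)) i := by
  simp [Matrix.mulVec, dotProduct]

/-- The reductions modulo `p` of the vectors `x` such that `M x` is divisible by `p ^ (a + 1)`. -/
def divKernel (a : ℕ) (M : Matrix ι ι ℤ_[p]) : Submodule (ZMod p) (ι → ZMod p) where
  carrier := {z | ∃ x : ι → ℤ_[p], (∀ j, PadicInt.toZMod (x j) = z j) ∧
    ∀ i, (p : ℤ_[p]) ^ (a + 1) ∣ M.mulVec x i}
  add_mem' := by
    rintro z w ⟨x, hx, hx'⟩ ⟨y, hy, hy'⟩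
    exact ⟨x + y, fun j => by simp [hx, hy], fun i => by
      simpa [Matrix.mulVec_add] using dvd_add (hx' i) (hy' i)⟩
  zero_mem' := ⟨0, by simp, by simp⟩
  smul_mem' := by
    rintro c z ⟨x, hx, hx'⟩
    exact ⟨(c.val : ℤ_[p]) • x, fun j => by simp [hx], fun i => by
      rw [Matrix.mulVec_smul]
      exact (hx' i).mul_left _⟩

lemma divKernel_succ_le (a : ℕ) (M : Matrix ι ι ℤ_[p]) : divKernel (a + 1) M ≤ divKernel a M :=
  fun _ ⟨x, hx, h⟩ => ⟨x, hx, fun i => (pow_dvd_pow _ (by omega)).trans (h i)⟩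

lemma divKernel_le_divKernel_mul (a : ℕ) (L M : Matrix ι ι ℤ_[p]) :
    divKernel a M ≤ divKernel a (L * M) := by
  rintro z ⟨x, hx, h⟩
  refine ⟨x, hx, fun i => ?_⟩
  rw [← Matrix.mulVec_mulVec]
  exact dvd_mulVec h L i

variable {N : ℕ}

lemma snDiag_mulVec (s : Fin N → WithTop ℕ) (x : Fin N → ℤ_[p]) (i : Fin N) :
    (snDiag p N s).mulVec x i = zppow p (s i) * x i := by
  simp [snDiag, Matrix.mulVec_diagonal]

lemma divKernel_snDiag (a : ℕ) (s : Fin N → WithTop ℕ) :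
    divKernel a (snDiag p N s) =
      supportedOn (ZMod p) (fun j => ((a + 1 : ℕ) : WithTop ℕ) ≤ s j) := by
  ext z
  constructor
  · rintro ⟨x, hx, h⟩ j hj
    rw [← hx j, toZMod_eq_zero_iff]
    refine dvd_of_pow_dvd_zppow_mul hj ?_
    simpa [snDiag_mulVec] using h j
  · intro hz
    refine ⟨liftVec z, fun j => by simp, fun j => ?_⟩
    rw [snDiag_mulVec]
    by_cases hj : ((a + 1 : ℕ) : WithTop ℕ) ≤ s j
    · exact (pow_dvd_zppow hj).mul_right _
    · simp [liftVec_eq_zero (hz j hj)]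

/-- The number of singular numbers exceeding `a` is the dimension of the `a`-th divisibility
kernel. -/
lemma finrank_divKernel (a : ℕ) {M : Matrix (Fin N) (Fin N) ℤ_[p]} {s : Fin N → WithTop ℕ}
    (h : IsSN p N M s) :
    Module.finrank (ZMod p) (divKernel a M) =
      (Finset.univ.filter fun j => ((a + 1 : ℕ) : WithTop ℕ) ≤ s j).card := by
  classical
  obtain ⟨-, U, V, rfl⟩ := h
  have hV : (V.val.map PadicInt.toZMod) * ((V⁻¹).val.map PadicInt.toZMod) = 1 := by
    rw [← Matrix.map_mul, Units.mul_inv]; simp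
  have hV' : ((V⁻¹).val.map PadicInt.toZMod) * (V.val.map PadicInt.toZMod) = 1 := by
    rw [← Matrix.map_mul, Units.inv_mul]; simp
  let e := Matrix.toLin'OfInv hV' hV
  have he : ∀ z, e z = (V.val.map PadicInt.toZMod).mulVec z := fun z => rfl
  have hmap : (divKernel a (U.val * snDiag p N s * V.val)).map (e : _ →ₗ[ZMod p] _) =
      divKernel a (snDiag p N s) := by
    ext w
    constructor
    · rintro ⟨z, ⟨x, hx, h⟩, rfl⟩
      refine ⟨V.val.mulVec x, fun j => ?_, fun i => ?_⟩
      · rw [toZMod_mulVec, funext hx]; exact (congrFun (he z) j).symm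
      · have h2 := dvd_mulVec h (U⁻¹).val i
        rw [Matrix.mulVec_mulVec, ← Matrix.mul_assoc, ← Matrix.mul_assoc, Units.inv_mul,
          Matrix.one_mul, ← Matrix.mulVec_mulVec] at h2
        exact h2
    · rintro ⟨y, hy, h⟩
      refine ⟨((V⁻¹).val.map PadicInt.toZMod).mulVec w, ⟨(V⁻¹).val.mulVec y, fun j => ?_, ?_⟩, ?_⟩
      · rw [toZMod_mulVec, funext hy]
      · intro i
        rw [Matrix.mulVec_mulVec, Matrix.mul_assoc, Units.mul_inv, Matrix.mul_one,
          ← Matrix.mulVec_mulVec]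
        exact dvd_mulVec h U.val i
      · change e _ = w
        rw [he, Matrix.mulVec_mulVec, hV, Matrix.one_mulVec]
  rw [← LinearEquiv.finrank_map_eq e, hmap, divKernel_snDiag, finrank_supportedOn]

end DivisibilityKernel

section CornerKernel

variable {p : ℕ} [Fact p.Prime] {N : ℕ}

/-- The vectors supported on `P` annihilated by the rows of `B` in which `lam` vanishes. -/
def cornerKer (B : Matrix (Fin N) (Fin N) (ZMod p)) (lam : Fin N → WithTop ℕ) (P : Fin N → Prop) :
    Submodule (ZMod p) (Fin N → ZMod p) where
  carrier := {z | z ∈ supportedOn (ZMod p) P ∧ ∀ i, lam i = 0 → B.mulVec z i = 0}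
  add_mem' := fun ha hb =>
    ⟨add_mem ha.1 hb.1, fun i hi => by simp [Matrix.mulVec_add, ha.2 i hi, hb.2 i hi]⟩
  zero_mem' := ⟨zero_mem _, by simp⟩
  smul_mem' := fun c a ha =>
    ⟨Submodule.smul_mem _ c ha.1, fun i hi => by simp [Matrix.mulVec_smul, ha.2 i hi]⟩

lemma cornerKer_mono {B : Matrix (Fin N) (Fin N) (ZMod p)} {lam : Fin N → WithTop ℕ}
    {P Q : Fin N → Prop} (h : ∀ j, P j → Q j) : cornerKer B lam P ≤ cornerKer B lam Q :=
  fun _ hz => ⟨supportedOn_mono h hz.1, hz.2⟩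

open Classical in
/-- Keep only the coordinates with `mu j = a`. -/
def levelProj (p : ℕ) (mu : Fin N → WithTop ℕ) (a : ℕ) :
    (Fin N → ZMod p) →ₗ[ZMod p] (Fin N → ZMod p) where
  toFun z j := if mu j = a then z j else 0
  map_add' z w := by ext j; by_cases h : mu j = a <;> simp [h]
  map_smul' c z := by ext j; by_cases h : mu j = a <;> simp [h]

omit [Fact p.Prime] in
lemma levelProj_of_eq {mu : Fin N → WithTop ℕ} {a : ℕ} {j : Fin N} (h : mu j = a)
    (z : Fin N → ZMod p) : levelProj p mu a z j = z j := if_pos h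

lemma levelProj_of_ne {mu : Fin N → WithTop ℕ} {a : ℕ} {j : Fin N} (h : mu j ≠ a)
    (z : Fin N → ZMod p) : levelProj p mu a z j = 0 := if_neg h

variable {A : Matrix (Fin N) (Fin N) ℤ_[p]} {lam mu : Fin N → WithTop ℕ} {d : ℕ}

lemma snDiag_mul_mul_mulVec (x : Fin N → ℤ_[p]) (i : Fin N) :
    (snDiag p N lam * A * snDiag p N mu).mulVec x i =
      zppow p (lam i) * A.mulVec (fun j => zppow p (mu j) * x j) i := by
  rw [Matrix.mul_assoc, ← Matrix.mulVec_mulVec, snDiag_mulVec, ← Matrix.mulVec_mulVec]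
  congr 2
  ext j
  rw [snDiag_mulVec]

lemma natCast_succ_le_iff {a : ℕ} {b : WithTop ℕ} :
    ((a + 1 : ℕ) : WithTop ℕ) ≤ b ↔ (a : WithTop ℕ) < b := by
  obtain rfl | ⟨b, rfl⟩ := eq_top_or_eq_natCast b
  · simp
  · norm_cast

lemma not_natCast_succ_le_iff {a : ℕ} {b : WithTop ℕ} :
    ¬ ((a + 1 : ℕ) : WithTop ℕ) ≤ b ↔ b ≤ a := by
  rw [natCast_succ_le_iff, not_lt]

lemma pow_dvd_of_cornerKer_eq_bot
    (hinj : cornerKer (A.map PadicInt.toZMod) lam (fun j => mu j < d) = ⊥) (c : ℕ) :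
    ∀ y : Fin N → ℤ_[p], (∀ j, (d : WithTop ℕ) ≤ mu j → (p : ℤ_[p]) ^ c ∣ y j) →
      (∀ i, lam i = 0 → (p : ℤ_[p]) ^ c ∣ A.mulVec y i) → ∀ j, (p : ℤ_[p]) ^ c ∣ y j := by
  induction c with
  | zero => simp
  | succ c ih =>
    intro y hy hA
    have h1 := ih y (fun j hj => (pow_dvd_pow _ (by omega)).trans (hy j hj))
      (fun i hi => (pow_dvd_pow _ (by omega)).trans (hA i hi))
    choose y' hy' using h1
    obtain rfl : y = (p : ℤ_[p]) ^ c • y' := by ext j; simp [hy' j]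
    have hpc : (p : ℤ_[p]) ^ c ≠ 0 := pow_ne_zero _ natCast_p_ne_zero
    have hcancel : ∀ u : ℤ_[p], (p : ℤ_[p]) ^ (c + 1) ∣ (p : ℤ_[p]) ^ c * u → (p : ℤ_[p]) ∣ u := by
      intro u hu
      rw [pow_succ] at hu
      exact (mul_dvd_mul_iff_left hpc).1 hu
    have hmem : (fun j => PadicInt.toZMod (y' j)) ∈
        cornerKer (A.map PadicInt.toZMod) lam (fun j => mu j < d) := by
      refine ⟨fun j hj => ?_, fun i hi => ?_⟩
      · exact toZMod_eq_zero_iff.2 (hcancel _ (hy j (not_lt.1 hj)))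
      · rw [← toZMod_mulVec, toZMod_eq_zero_iff]
        refine hcancel _ ?_
        simpa [Matrix.mulVec_smul] using hA i hi
    rw [hinj, Submodule.mem_bot] at hmem
    intro j
    have := toZMod_eq_zero_iff.1 (congrFun hmem j)
    rw [pow_succ]
    exact mul_dvd_mul_left _ this

lemma divKernel_snDiag_le (a : ℕ) :
    divKernel a (snDiag p N mu) ≤ divKernel a (snDiag p N lam * A * snDiag p N mu) :=
  divKernel_le_divKernel_mul a _ _

lemma divKernel_eq_of_lt
    (hinj : cornerKer (A.map PadicInt.toZMod) lam (fun j => mu j < d) = ⊥) {a : ℕ} (ha : a < d) :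
    divKernel a (snDiag p N lam * A * snDiag p N mu) = divKernel a (snDiag p N mu) := by
  refine le_antisymm ?_ (divKernel_snDiag_le a)
  rintro z ⟨x, hx, h⟩
  refine ⟨x, hx, fun j => ?_⟩
  rw [snDiag_mulVec]
  refine pow_dvd_of_cornerKer_eq_bot hinj (a + 1) (fun j => zppow p (mu j) * x j)
    (fun j hj => ?_) (fun i hi => ?_) j
  · exact (pow_dvd_zppow ((Nat.cast_le.2 ha).trans hj)).mul_right _
  · simpa [snDiag_mul_mul_mulVec, hi, zppow_zero] using h i

lemma levelProj_mem_divKernel {a : ℕ} {z : Fin N → ZMod p}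
    (hz : z ∈ cornerKer (A.map PadicInt.toZMod) lam (fun j => mu j ≤ a)) :
    levelProj p mu a z ∈ divKernel a (snDiag p N lam * A * snDiag p N mu) := by
  have hlift : ∀ j, ∃ x : ℤ_[p], PadicInt.toZMod x = levelProj p mu a z j ∧
      zppow p (mu j) * x = (p : ℤ_[p]) ^ a * liftVec z j := by
    intro j
    by_cases hj : mu j = a
    · exact ⟨liftVec z j, by simp [levelProj_of_eq hj], by rw [hj, zppow_natCast]⟩
    rw [levelProj_of_ne hj]
    by_cases hj' : mu j ≤ a
    · have hlt := lt_of_le_of_ne hj' hj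
      obtain ⟨e, he, h1, h2⟩ := exists_zppow_eq (p := p) (not_natCast_succ_le_iff.2 hj')
      have hea : e < a := by
        rw [h1] at hlt
        exact_mod_cast hlt
      refine ⟨(p : ℤ_[p]) ^ (a - e) * liftVec z j, ?_, ?_⟩
      · rw [toZMod_eq_zero_iff]
        exact (dvd_pow_self _ (by omega)).mul_right _
      · rw [h2, ← mul_assoc, ← pow_add]
        congr 2
        omega
    · exact ⟨0, by simp, by simp [liftVec_eq_zero (hz.1 j hj')]⟩
  choose x hx hx' using hlift
  refine ⟨x, hx, fun i => ?_⟩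
  rw [snDiag_mul_mul_mulVec, funext hx']
  have hsm : (fun j => (p : ℤ_[p]) ^ a * liftVec z j) = (p : ℤ_[p]) ^ a • liftVec z := rfl
  rw [hsm, Matrix.mulVec_smul]
  simp only [Pi.smul_apply, smul_eq_mul]
  by_cases hi : lam i = 0
  · have h0 : (p : ℤ_[p]) ∣ A.mulVec (liftVec z) i := by
      rw [← toZMod_eq_zero_iff, toZMod_mulVec]
      simpa using hz.2 i hi
    rw [pow_succ]
    exact (mul_dvd_mul_left _ h0).mul_left _
  · have h1 : (p : ℤ_[p]) ^ 1 ∣ zppow p (lam i) := by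
      apply pow_dvd_zppow
      rw [← zero_add 1, natCast_succ_le_iff]
      exact pos_iff_ne_zero.2 hi
    rw [pow_one] at h1
    rw [pow_succ, mul_left_comm]
    exact mul_dvd_mul_left _ (h1.mul_right _)

lemma cornerKer_eq_bot_of_divKernel_eq
    (h : ∀ a < d, divKernel a (snDiag p N lam * A * snDiag p N mu) =
      divKernel a (snDiag p N mu)) :
    cornerKer (A.map PadicInt.toZMod) lam (fun j => mu j < d) = ⊥ := by
  classical
  rw [eq_bot_iff]
  intro z hz
  rw [Submodule.mem_bot]
  by_contra hne
  obtain ⟨j, hj⟩ := Function.ne_iff.1 hne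
  obtain ⟨k, hk, hmax⟩ := Finset.exists_max_image (Finset.univ.filter fun j => z j ≠ 0) mu
    ⟨j, by simpa using hj⟩
  have hk0 : z k ≠ 0 := by simpa using hk
  have hkd : mu k < d := by
    by_contra h'
    exact hk0 (hz.1 k h')
  obtain h' | ⟨a, ha⟩ := eq_top_or_eq_natCast (mu k)
  · simp [h'] at hkd
  have had : a < d := by rw [ha] at hkd; exact_mod_cast hkd
  have hmem : z ∈ cornerKer (A.map PadicInt.toZMod) lam (fun j => mu j ≤ a) := by
    refine ⟨fun j hj => ?_, hz.2⟩
    by_contra hzj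
    exact hj (ha ▸ hmax j (by simpa using hzj))
  have := levelProj_mem_divKernel hmem
  rw [h a had, divKernel_snDiag] at this
  refine hk0 ?_
  rw [← levelProj_of_eq ha z]
  exact this k (not_natCast_succ_le_iff.2 ha.le)

lemma exists_eq_pow_mul_of_cornerKer_eq_bot
    (hinj : cornerKer (A.map PadicInt.toZMod) lam (fun j => mu j < d) = ⊥) {e : ℕ}
    {x : Fin N → ℤ_[p]}
    (hx : ∀ i, (p : ℤ_[p]) ^ (d + e) ∣ (snDiag p N lam * A * snDiag p N mu).mulVec x i) :
    ∃ y : Fin N → ℤ_[p], (∀ j, zppow p (mu j) * x j = (p : ℤ_[p]) ^ d * y j) ∧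
      ∀ i, lam i = 0 → (p : ℤ_[p]) ^ e ∣ A.mulVec y i := by
  have hA : ∀ i, lam i = 0 →
      (p : ℤ_[p]) ^ (d + e) ∣ A.mulVec (fun j => zppow p (mu j) * x j) i := fun i hi => by
    simpa [snDiag_mul_mul_mulVec, hi, zppow_zero] using hx i
  have h := pow_dvd_of_cornerKer_eq_bot hinj d (fun j => zppow p (mu j) * x j)
    (fun j hj => (pow_dvd_zppow hj).mul_right _)
    (fun i hi => (pow_dvd_pow _ (by omega)).trans (hA i hi))
  choose y hy using h
  refine ⟨y, hy, fun i hi => ?_⟩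
  have h1 := hA i hi
  have hsm : (fun j => (p : ℤ_[p]) ^ d * y j) = (p : ℤ_[p]) ^ d • y := rfl
  rw [funext hy, hsm, Matrix.mulVec_smul, pow_add] at h1
  exact (mul_dvd_mul_iff_left (pow_ne_zero _ natCast_p_ne_zero)).1 h1

lemma eq_of_mul_zppow_eq {j : Fin N} {x y : ℤ_[p]} (hj : mu j = d)
    (h : zppow p (mu j) * x = (p : ℤ_[p]) ^ d * y) : y = x := by
  rw [hj, zppow_natCast] at h
  exact (mul_left_cancel₀ (pow_ne_zero _ natCast_p_ne_zero) h).symm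

lemma dvd_of_mul_zppow_eq {j : Fin N} {x y : ℤ_[p]} (hj : ¬ mu j ≤ d)
    (h : zppow p (mu j) * x = (p : ℤ_[p]) ^ d * y) (u : ℤ_[p]) (hu : u ∣ x) :
    (p : ℤ_[p]) * u ∣ y := by
  have h1 : (p : ℤ_[p]) ^ (d + 1) ∣ zppow p (mu j) :=
    pow_dvd_zppow (natCast_succ_le_iff.2 (not_le.1 hj))
  have h2 := mul_dvd_mul h1 hu
  rw [h, pow_succ, mul_assoc] at h2
  exact (mul_dvd_mul_iff_left (pow_ne_zero _ natCast_p_ne_zero)).1 h2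

lemma divKernel_eq_sup
    (hinj : cornerKer (A.map PadicInt.toZMod) lam (fun j => mu j < d) = ⊥) :
    divKernel d (snDiag p N lam * A * snDiag p N mu) = divKernel d (snDiag p N mu) ⊔
      (cornerKer (A.map PadicInt.toZMod) lam (fun j => mu j ≤ d)).map (levelProj p mu d) := by
  refine le_antisymm ?_ (sup_le (divKernel_snDiag_le d) ?_)
  · rintro z ⟨x, hx, h⟩
    obtain ⟨y, hy, hA⟩ := exists_eq_pow_mul_of_cornerKer_eq_bot (e := 1) hinj h
    have hmem : (fun j => PadicInt.toZMod (y j)) ∈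
        cornerKer (A.map PadicInt.toZMod) lam (fun j => mu j ≤ d) := by
      refine ⟨fun j hj => ?_, fun i hi => ?_⟩
      · rw [toZMod_eq_zero_iff]
        simpa using dvd_of_mul_zppow_eq hj (hy j) 1 (one_dvd _)
      · rw [← toZMod_mulVec, toZMod_eq_zero_iff]
        simpa using hA i hi
    have hz : z = (z - levelProj p mu d (fun j => PadicInt.toZMod (y j))) +
        levelProj p mu d (fun j => PadicInt.toZMod (y j)) := by simp
    rw [hz]
    refine Submodule.add_mem_sup ?_ (Submodule.mem_map_of_mem hmem)
    rw [divKernel_snDiag]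
    intro j hj
    by_cases hjd : mu j = d
    · simp [levelProj_of_eq hjd, ← hx j, eq_of_mul_zppow_eq hjd (hy j)]
    · simp only [Pi.sub_apply, levelProj_of_ne hjd, sub_zero]
      have hlt := lt_of_le_of_ne (not_natCast_succ_le_iff.1 hj) hjd
      rcases d with _ | d
      · simp at hlt
      rw [← hx j, toZMod_eq_zero_iff]
      refine dvd_of_pow_dvd_zppow_mul (c := d) (a := mu j) (not_le.2 hlt) ?_
      rw [hy j]
      exact dvd_mul_right _ _
  · rintro _ ⟨z, hz, rfl⟩
    exact levelProj_mem_divKernel hz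

lemma finrank_divKernel_eq_add
    (hinj : cornerKer (A.map PadicInt.toZMod) lam (fun j => mu j < d) = ⊥) :
    Module.finrank (ZMod p) (divKernel d (snDiag p N lam * A * snDiag p N mu)) =
      Module.finrank (ZMod p) (divKernel d (snDiag p N mu)) +
      Module.finrank (ZMod p) (cornerKer (A.map PadicInt.toZMod) lam (fun j => mu j ≤ d)) := by
  set K := cornerKer (A.map PadicInt.toZMod) lam (fun j => mu j ≤ d) with hK
  have hdisj : divKernel d (snDiag p N mu) ⊓ K.map (levelProj p mu d) = ⊥ := by
    rw [eq_bot_iff]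
    rintro _ ⟨h1, z, -, rfl⟩
    rw [Submodule.mem_bot]
    rw [SetLike.mem_coe, divKernel_snDiag] at h1
    ext j
    by_cases hj : mu j = d
    · exact h1 j (not_natCast_succ_le_iff.2 hj.le)
    · simp [levelProj_of_ne hj]
  have hker : Function.Injective ((levelProj p mu d).domRestrict K) := by
    rw [← LinearMap.ker_eq_bot, eq_bot_iff]
    rintro ⟨z, hz⟩ h
    have h' : levelProj p mu d z = 0 := h
    have hmem : z ∈ cornerKer (A.map PadicInt.toZMod) lam (fun j => mu j < d) := by
      refine ⟨fun j hj => ?_, hz.2⟩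
      by_cases hjd : mu j = d
      · rw [← levelProj_of_eq hjd z, h']; rfl
      · exact hz.1 j fun h => hj (lt_of_le_of_ne h hjd)
    rw [hinj, Submodule.mem_bot] at hmem
    simpa using hmem
  have hrange : K.map (levelProj p mu d) = LinearMap.range ((levelProj p mu d).domRestrict K) := by
    rw [LinearMap.range_domRestrict]
  have h := Submodule.finrank_sup_add_finrank_inf_eq (divKernel d (snDiag p N mu))
    (K.map (levelProj p mu d))
  rw [hdisj, finrank_bot, add_zero] at h
  rw [divKernel_eq_sup hinj, h, hrange, LinearMap.finrank_range_of_inj hker]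

lemma finrank_divKernel_succ_lt
    (hinj : cornerKer (A.map PadicInt.toZMod) lam (fun j => mu j < d) = ⊥)
    {z : Fin N → ZMod p}
    (hz : z ∈ cornerKer (A.map PadicInt.toZMod) lam (fun j => mu j ≤ d))
    (hsecond : ∀ w : Fin N → ℤ_[p], (∀ j, ¬ mu j ≤ d → (p : ℤ_[p]) ∣ w j) →
      ∃ i, lam i = 0 ∧ ¬ (p : ℤ_[p]) ^ 2 ∣ A.mulVec (liftVec z + (p : ℤ_[p]) • w) i) :
    Module.finrank (ZMod p) (divKernel (d + 1) (snDiag p N lam * A * snDiag p N mu)) <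
      Module.finrank (ZMod p) (divKernel d (snDiag p N lam * A * snDiag p N mu)) := by
  refine Submodule.finrank_lt_finrank_of_lt
    (lt_of_le_of_ne (divKernel_succ_le d _) fun heq => ?_)
  have hmem := levelProj_mem_divKernel hz
  rw [← heq] at hmem
  obtain ⟨x, hx, h⟩ := hmem
  obtain ⟨y, hy, hA⟩ := exists_eq_pow_mul_of_cornerKer_eq_bot (e := 2) hinj h
  have hoff : ∀ j, ¬ mu j ≤ d → (p : ℤ_[p]) * p ∣ y j := fun j hj => by
    refine dvd_of_mul_zppow_eq hj (hy j) p ?_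
    rw [← toZMod_eq_zero_iff, hx j, levelProj_of_ne fun h => hj h.le]
  have hyz : (fun j => PadicInt.toZMod (y j)) - z ∈
      cornerKer (A.map PadicInt.toZMod) lam (fun j => mu j < d) := by
    refine ⟨fun j hj => ?_, fun i hi => ?_⟩
    · by_cases hjd : mu j = d
      · simp [eq_of_mul_zppow_eq hjd (hy j), hx j, levelProj_of_eq hjd]
      · have hj' : ¬ mu j ≤ d := fun h => hj (lt_of_le_of_ne h hjd)
        have h0 : PadicInt.toZMod (y j) = 0 :=
          toZMod_eq_zero_iff.2 (dvd_of_mul_left_dvd (hoff j hj'))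
        simp [h0, hz.1 j hj']
    · have h0 : PadicInt.toZMod (A.mulVec y i) = 0 :=
        toZMod_eq_zero_iff.2 ((dvd_pow_self _ two_ne_zero).trans (hA i hi))
      rw [Matrix.mulVec_sub, Pi.sub_apply, ← toZMod_mulVec, h0, hz.2 i hi, sub_zero]
  rw [hinj, Submodule.mem_bot, sub_eq_zero] at hyz
  have hw : ∀ j, (p : ℤ_[p]) ∣ y j - liftVec z j := fun j => by
    rw [← toZMod_eq_zero_iff, map_sub, toZMod_liftVec, ← hyz, sub_self]
  choose w hw using hw
  obtain rfl : y = liftVec z + (p : ℤ_[p]) • w := by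
    ext j
    simp [← hw j]
  obtain ⟨i, hi, h2⟩ := hsecond w fun j hj => by
    have := hoff j hj
    simp only [Pi.add_apply, liftVec_eq_zero (hz.1 j hj), zero_add, Pi.smul_apply,
      smul_eq_mul] at this
    exact (mul_dvd_mul_iff_left natCast_p_ne_zero).1 this
  exact h2 (hA i hi)

end CornerKernel

section SingleBox

lemma le_apply_iff_lt_card {N : ℕ} {s : Fin N → WithTop ℕ} (hs : Antitone s) (c : WithTop ℕ)
    (j : Fin N) : c ≤ s j ↔ (j : ℕ) < (Finset.univ.filter fun i => c ≤ s i).card := by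
  constructor
  · intro h
    have : Finset.Iic j ⊆ Finset.univ.filter fun i => c ≤ s i := fun i hi => by
      simpa using h.trans (hs (Finset.mem_Iic.1 hi))
    have h2 := Finset.card_le_card this
    rw [Fin.card_Iic] at h2
    omega
  · intro h
    by_contra hc
    have : (Finset.univ.filter fun i => c ≤ s i) ⊆ Finset.Iio j := fun i hi => by
      rw [Finset.mem_Iio]
      by_contra hij
      exact hc ((by simpa using hi : c ≤ s i).trans (hs (not_lt.1 hij)))
    have h2 := Finset.card_le_card this
    rw [Fin.card_Iio] at h2
    omega

variable {p : ℕ} [Fact p.Prime] {N : ℕ} {A : Matrix (Fin N) (Fin N) ℤ_[p]}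
  {lam mu s : Fin N → WithTop ℕ} {d : ℕ} {ρ : Fin N}

lemma finrank_divKernel_snDiag (a : ℕ) :
    Module.finrank (ZMod p) (divKernel a (snDiag p N mu)) =
      (Finset.univ.filter fun j => ((a + 1 : ℕ) : WithTop ℕ) ≤ mu j).card := by
  rw [divKernel_snDiag, finrank_supportedOn]

/-- The corner kernel is a line with no nonzero vector supported below level `d` if and only if it
is spanned by a vector charging level `d`. -/
lemma cornerKer_eq_bot_and_finrank_eq_one_iff {B : Matrix (Fin N) (Fin N) (ZMod p)} :
    (cornerKer B lam (fun j => mu j < d) = ⊥ ∧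
      Module.finrank (ZMod p) (cornerKer B lam (fun j => mu j ≤ d)) = 1) ↔
    ∃ z, (∃ j, mu j = d ∧ z j ≠ 0) ∧
      cornerKer B lam (fun j => mu j ≤ d) = Submodule.span (ZMod p) {z} := by
  constructor
  · rintro ⟨hinj, h1⟩
    obtain ⟨⟨z, hz⟩, hz0, hspan⟩ := finrank_eq_one_iff'.1 h1
    refine ⟨z, ?_, le_antisymm ?_ ?_⟩
    · by_contra! hz'
      have hmem : z ∈ cornerKer B lam (fun j => mu j < d) := by
        refine ⟨fun j hj => ?_, hz.2⟩
        by_cases hjd : mu j = d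
        · exact hz' j hjd
        · exact hz.1 j fun h => hj (lt_of_le_of_ne h hjd)
      rw [hinj, Submodule.mem_bot] at hmem
      exact hz0 (by simpa using hmem)
    · intro w hw
      obtain ⟨c, hc⟩ := hspan ⟨w, hw⟩
      exact Submodule.mem_span_singleton.2 ⟨c, congrArg Subtype.val hc⟩
    · rwa [Submodule.span_singleton_le_iff_mem]
  · rintro ⟨z, ⟨j, hj, hzj⟩, hspan⟩
    refine ⟨?_, ?_⟩
    · rw [eq_bot_iff]
      intro w hw
      have hw' := cornerKer_mono (fun j hj => hj.le : ∀ j, mu j < d → mu j ≤ d) hw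
      rw [hspan] at hw'
      obtain ⟨c, rfl⟩ := Submodule.mem_span_singleton.1 hw'
      have h0 : c * z j = 0 := hw.1 j (not_lt.2 hj.ge)
      rcases mul_eq_zero.1 h0 with rfl | h
      · simp
      · exact absurd h hzj
    · rw [hspan]
      exact finrank_span_singleton (by rintro rfl; exact hzj rfl)

lemma exists_cornerKer_eq_span_of_isSN
    (hs : IsSN p N (snDiag p N lam * A * snDiag p N mu) s)
    (hd : mu ρ = d) (hJ : ∀ j, mu j ≤ d ↔ ρ ≤ j)
    (hρ : s ρ = mu ρ + 1) (hgt : ∀ j, ρ < j → s j = mu j) :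
    ∃ z, (∃ j, mu j = d ∧ z j ≠ 0) ∧
      cornerKer (A.map PadicInt.toZMod) lam (fun j => mu j ≤ d) =
        Submodule.span (ZMod p) {z} := by
  have hρ' : s ρ = ((d + 1 : ℕ) : WithTop ℕ) := by rw [hρ, hd]; push_cast; rfl
  have hge : ∀ j, j ≤ ρ → ((d + 1 : ℕ) : WithTop ℕ) ≤ s j := fun j hj => hρ' ▸ hs.1 hj
  have hlow : ∀ a < d, divKernel a (snDiag p N lam * A * snDiag p N mu) =
      divKernel a (snDiag p N mu) := by
    intro a ha
    refine (Submodule.eq_of_le_of_finrank_eq (divKernel_snDiag_le a) ?_).symm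
    rw [finrank_divKernel_snDiag, finrank_divKernel a hs]
    congr 1
    refine Finset.filter_congr fun j _ => ?_
    rcases le_or_gt j ρ with hj | hj
    · have h1 : ((a + 1 : ℕ) : WithTop ℕ) ≤ s j := (Nat.cast_le.2 (by omega)).trans (hge j hj)
      have h2 : ((a + 1 : ℕ) : WithTop ℕ) ≤ mu j := by
        have h3 : (d : WithTop ℕ) ≤ mu j := by
          rcases hj.eq_or_lt with rfl | hj
          · exact hd.ge
          · exact (not_le.1 fun h => absurd ((hJ j).1 h) (not_le.2 hj)).le
        exact (Nat.cast_le.2 ha).trans h3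
      exact iff_of_true h2 h1
    · rw [hgt j hj]
  have hinj := cornerKer_eq_bot_of_divKernel_eq hlow
  refine cornerKer_eq_bot_and_finrank_eq_one_iff.1 ⟨hinj, ?_⟩
  have hadd := finrank_divKernel_eq_add hinj
  rw [finrank_divKernel d hs, finrank_divKernel_snDiag] at hadd
  have hins : (Finset.univ.filter fun j => ((d + 1 : ℕ) : WithTop ℕ) ≤ s j) =
      insert ρ (Finset.univ.filter fun j => ((d + 1 : ℕ) : WithTop ℕ) ≤ mu j) := by
    ext j
    simp only [Finset.mem_filter_univ, Finset.mem_insert]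
    rcases lt_trichotomy j ρ with hj | rfl | hj
    · have : ((d + 1 : ℕ) : WithTop ℕ) ≤ mu j := by
        rw [natCast_succ_le_iff, ← not_le, hJ j]
        exact not_le.2 hj
      exact iff_of_true (hge j hj.le) (Or.inr this)
    · exact iff_of_true (hge j le_rfl) (Or.inl rfl)
    · simp [hgt j hj, hj.ne']
  rw [hins, Finset.card_insert_of_notMem] at hadd
  · omega
  · rw [Finset.mem_filter_univ, not_natCast_succ_le_iff]
    exact hd.le

lemma exists_isSN_of_cornerKer_eq_span (hmu : Antitone mu)
    (hd : mu ρ = d) (hJ : ∀ j, mu j ≤ d ↔ ρ ≤ j) {z : Fin N → ZMod p}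
    (hz : ∃ j, mu j = d ∧ z j ≠ 0)
    (hspan : cornerKer (A.map PadicInt.toZMod) lam (fun j => mu j ≤ d) =
        Submodule.span (ZMod p) {z})
    (hsecond : ∀ w : Fin N → ℤ_[p], (∀ j, ¬ mu j ≤ d → (p : ℤ_[p]) ∣ w j) →
      ∃ i, lam i = 0 ∧ ¬ (p : ℤ_[p]) ^ 2 ∣ A.mulVec (liftVec z + (p : ℤ_[p]) • w) i) :
    ∃ s, IsSN p N (snDiag p N lam * A * snDiag p N mu) s ∧ s ρ = mu ρ + 1 ∧
      ∀ j, ρ < j → s j = mu j := by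
  obtain ⟨s, hs⟩ := exists_isSN N (snDiag p N lam * A * snDiag p N mu)
  obtain ⟨hinj, h1⟩ := cornerKer_eq_bot_and_finrank_eq_one_iff.2 ⟨z, hz, hspan⟩
  have hlow : ∀ c ≤ d, ∀ j, ((c : ℕ) : WithTop ℕ) ≤ s j ↔ ((c : ℕ) : WithTop ℕ) ≤ mu j := by
    intro c hc j
    rcases c with _ | a
    · simp
    · rw [le_apply_iff_lt_card hs.1, le_apply_iff_lt_card hmu, ← finrank_divKernel a hs,
        ← finrank_divKernel_snDiag (p := p) a, divKernel_eq_of_lt hinj hc]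
  have hcard : (Finset.univ.filter fun j => ((d + 1 : ℕ) : WithTop ℕ) ≤ mu j).card = ρ := by
    rw [← Fin.card_Iio ρ]
    congr 1
    ext j
    rw [Finset.mem_filter_univ, natCast_succ_le_iff, ← not_le, hJ j, not_le, Finset.mem_Iio]
  have hadd := finrank_divKernel_eq_add hinj
  rw [finrank_divKernel_snDiag, hcard, h1] at hadd
  have hlt := finrank_divKernel_succ_lt hinj
    (hspan ▸ Submodule.mem_span_singleton_self z) hsecond
  rw [hadd] at hlt
  rw [finrank_divKernel _ hs] at hadd hlt
  have hd1 : ∀ j, ((d + 1 : ℕ) : WithTop ℕ) ≤ s j ↔ j ≤ ρ := fun j => by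
    rw [le_apply_iff_lt_card hs.1, hadd, Fin.le_def]
    omega
  refine ⟨s, hs, ?_, fun j hj => ?_⟩
  · refine le_antisymm ?_ ?_
    · have h2 : ¬ ((d + 1 + 1 : ℕ) : WithTop ℕ) ≤ s ρ := by
        rw [le_apply_iff_lt_card hs.1]
        omega
      have := not_natCast_succ_le_iff.1 h2
      rw [hd]
      exact_mod_cast this
    · rw [hd]
      exact_mod_cast (hd1 ρ).2 le_rfl
  · have h2 : s j ≤ d := not_natCast_succ_le_iff.1 fun h => absurd ((hd1 j).1 h) (not_le.2 hj)
    have h3 : mu j ≤ d := (hJ j).2 hj.le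
    obtain h | ⟨a, ha⟩ := eq_top_or_eq_natCast (s j)
    · simp [h] at h2
    obtain h | ⟨b, hb⟩ := eq_top_or_eq_natCast (mu j)
    · simp [h] at h3
    refine le_antisymm ?_ ?_
    · rw [ha]
      refine (hlow a ?_ j).1 ha.ge
      rw [ha] at h2
      exact_mod_cast h2
    · rw [hb]
      refine (hlow b ?_ j).2 hb.ge
      rw [hb] at h3
      exact_mod_cast h3

end SingleBox

section CountLinearMaps

open Module

variable {F : Type*} [Field F] [Fintype F] {V W W₁ W₂ : Type*}
  [AddCommGroup V] [Module F V] [AddCommGroup W] [Module F W]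
  [AddCommGroup W₁] [Module F W₁] [AddCommGroup W₂] [Module F W₂]

lemma linearIndependent_comp_basis_iff {K : Type*} [Field K] [Module K V] [Module K W]
    {ι : Type*} (b : Basis ι K V) (f : V →ₗ[K] W) :
    LinearIndependent K (f ∘ b) ↔ Function.Injective f := by
  refine ⟨fun h => ?_, fun h => b.linearIndependent.map' f (LinearMap.ker_eq_bot.2 h)⟩
  have hc : b.constr K (f ∘ b) = f := b.constr_self K f
  rw [← hc]
  exact b.injective_constr_of_linearIndependent h

lemma natCard_injective_linearMap [FiniteDimensional F V] [FiniteDimensional F W]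
    (h : finrank F V ≤ finrank F W) :
    Nat.card {f : V →ₗ[F] W // Function.Injective f} =
      ∏ i : Fin (finrank F V), (Fintype.card F ^ finrank F W - Fintype.card F ^ (i : ℕ)) := by
  have : Finite W := Module.finite_of_finite F
  rw [← card_linearIndependent h]
  let b := finBasis F V
  refine Nat.card_congr ((b.constr F).symm.toEquiv.subtypeEquiv fun f => ?_)
  rw [← linearIndependent_comp_basis_iff b]
  rfl

lemma natCard_linearMap_ker_eq (K : Submodule F V) [FiniteDimensional F V]
    [FiniteDimensional F W] (h : finrank F (V ⧸ K) ≤ finrank F W) :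
    Nat.card {g : V →ₗ[F] W // LinearMap.ker g = K} =
      ∏ i : Fin (finrank F (V ⧸ K)), (Fintype.card F ^ finrank F W - Fintype.card F ^ (i : ℕ)) := by
  rw [← natCard_injective_linearMap h]
  refine Nat.card_congr
    { toFun := fun g => ⟨K.liftQ g.1 g.2.ge, ?_⟩
      invFun := fun f => ⟨f.1.comp K.mkQ, ?_⟩
      left_inv := fun g => ?_
      right_inv := fun f => ?_ }
  · rw [← LinearMap.ker_eq_bot, Submodule.ker_liftQ_eq_bot']
    exact g.2.symm
  · rw [LinearMap.ker_comp, LinearMap.ker_eq_bot.2 f.2, ← LinearMap.ker, Submodule.ker_mkQ]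
  · ext x
    simp
  · ext x
    simp

lemma natCard_linearMap_apply_ne_zero [FiniteDimensional F V] [FiniteDimensional F W]
    {z : V} (hz : z ≠ 0) :
    Nat.card {f : V →ₗ[F] W // f z ≠ 0} =
      Fintype.card F ^ (finrank F W * finrank F V) -
        Fintype.card F ^ (finrank F W * (finrank F V - 1)) := by
  classical
  have hfin : Finite (V →ₗ[F] W) := Module.finite_of_finite F
  have := Fintype.ofFinite (V →ₗ[F] W)
  let ev : (V →ₗ[F] W) →ₗ[F] W := LinearMap.applyₗ z
  have hsurj : LinearMap.range ev = ⊤ := by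
    rw [LinearMap.range_eq_top]
    intro w
    obtain ⟨φ, hφ⟩ : ∃ φ : V →ₗ[F] F, φ z ≠ 0 := by
      by_contra! h
      exact hz ((Module.forall_dual_apply_eq_zero_iff F z).1 h)
    refine ⟨φ.smulRight ((φ z)⁻¹ • w), ?_⟩
    simp [ev, smul_smul, hφ]
  have hpos : 0 < finrank F V := Module.finrank_pos_iff_exists_ne_zero.2 ⟨z, hz⟩
  have hker : finrank F (LinearMap.ker ev) = finrank F W * (finrank F V - 1) := by
    have := LinearMap.finrank_range_add_finrank_ker ev
    rw [hsurj, finrank_top, finrank_linearMap] at this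
    obtain ⟨k, hk⟩ := Nat.exists_eq_add_of_lt hpos
    rw [hk] at this ⊢
    simp only [zero_add, add_tsub_cancel_right] at this ⊢
    nlinarith
  have hc1 : Nat.card (V →ₗ[F] W) = Fintype.card F ^ (finrank F W * finrank F V) := by
    rw [Module.natCard_eq_pow_finrank (K := F), finrank_linearMap, Nat.card_eq_fintype_card,
      mul_comm]
  have hc2 : Nat.card {f : V →ₗ[F] W // f z = 0} =
      Fintype.card F ^ (finrank F W * (finrank F V - 1)) := by
    rw [← hker, ← Nat.card_eq_fintype_card, ← Module.natCard_eq_pow_finrank]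
    rfl
  rw [← hc1, ← hc2, Nat.card_eq_fintype_card, Nat.card_eq_fintype_card, Nat.card_eq_fintype_card]
  exact Fintype.card_subtype_compl fun f : V →ₗ[F] W => f z = 0

lemma natCard_linearMap_prod (e : W ≃ₗ[F] W₁ × W₂) [FiniteDimensional F V]
    [FiniteDimensional F W₁] [FiniteDimensional F W₂] {z : V} (hz : z ≠ 0)
    (h : finrank F V ≤ finrank F W₂ + 1) :
    Nat.card {f : V →ₗ[F] W // LinearMap.ker ((LinearMap.snd F W₁ W₂ ∘ₗ e.toLinearMap) ∘ₗ f) =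
        Submodule.span F {z} ∧ f z ≠ 0} =
      (Fintype.card F ^ (finrank F W₁ * finrank F V) -
        Fintype.card F ^ (finrank F W₁ * (finrank F V - 1))) *
      ∏ i : Fin (finrank F V - 1), (Fintype.card F ^ finrank F W₂ - Fintype.card F ^ (i : ℕ)) := by
  have hquot : finrank F (V ⧸ Submodule.span F {z}) = finrank F V - 1 := by
    have := (Submodule.span F {z}).finrank_quotient_add_finrank
    rw [finrank_span_singleton hz] at this
    omega
  have h2 := natCard_linearMap_ker_eq (W := W₂) (Submodule.span F {z}) (by omega)
  rw [hquot] at h2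
  rw [← natCard_linearMap_apply_ne_zero (W := W₁) hz, ← h2, ← Nat.card_prod]
  have hzz := Submodule.mem_span_singleton_self (R := F) z
  refine Nat.card_congr
    { toFun := fun f => (⟨(LinearMap.fst F W₁ W₂ ∘ₗ e.toLinearMap) ∘ₗ f.1, ?_⟩,
        ⟨(LinearMap.snd F W₁ W₂ ∘ₗ e.toLinearMap) ∘ₗ f.1, f.2.1⟩)
      invFun := fun g => ⟨e.symm.toLinearMap ∘ₗ g.1.1.prod g.2.1, ?_, ?_⟩
      left_inv := fun f => ?_
      right_inv := fun g => ?_ }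
  · intro h0
    have h1 : ((LinearMap.snd F W₁ W₂ ∘ₗ e.toLinearMap) ∘ₗ f.1) z = 0 := by
      rw [← LinearMap.mem_ker, f.2.1]
      exact hzz
    refine f.2.2 (e.injective ?_)
    rw [map_zero]
    exact Prod.ext h0 h1
  · have hg : (LinearMap.snd F W₁ W₂ ∘ₗ e.toLinearMap) ∘ₗ
        (e.symm.toLinearMap ∘ₗ g.1.1.prod g.2.1) = g.2.1 := by
      ext x
      simp
    rw [hg]
    exact g.2.2
  · intro h0
    have h1 := congrArg e h0
    simp only [LinearMap.comp_apply, LinearEquiv.coe_coe, LinearEquiv.apply_symm_apply,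
      map_zero] at h1
    exact g.1.2 (congrArg Prod.fst h1)
  · ext x
    apply e.injective
    simp
  · ext x <;> simp

lemma natCard_span_singleton_eq {z₀ : V} (hz₀ : z₀ ≠ 0) :
    Nat.card {z : V // Submodule.span F {z₀} = Submodule.span F {z}} = Fintype.card F - 1 := by
  classical
  rw [← Fintype.card_units, ← Nat.card_eq_fintype_card]
  refine (Nat.card_congr (Equiv.ofBijective
    (fun c : Fˣ => ⟨c • z₀, (Submodule.span_singleton_group_smul_eq F c z₀).symm⟩) ⟨?_, ?_⟩)).symm
  · intro c c' h
    have h1 : (c : F) • z₀ = (c' : F) • z₀ := congrArg Subtype.val h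
    exact Units.ext (smul_left_injective F hz₀ h1)
  · rintro ⟨z, hz⟩
    obtain ⟨c, hc⟩ := Submodule.span_singleton_eq_span_singleton.1 hz
    exact ⟨c, Subtype.ext hc⟩

/-- The injective maps whose second component has kernel a line outside `V₀`, counted. -/
lemma natCard_good_linearMap (e : W ≃ₗ[F] W₁ × W₂) [FiniteDimensional F V]
    [FiniteDimensional F W₁] [FiniteDimensional F W₂] (V₀ : Submodule F V)
    (h : finrank F V ≤ finrank F W₂ + 1) :
    (Fintype.card F - 1) * Nat.card {f : V →ₗ[F] W // Function.Injective f ∧ ∃ z ∉ V₀,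
        LinearMap.ker ((LinearMap.snd F W₁ W₂ ∘ₗ e.toLinearMap) ∘ₗ f) = Submodule.span F {z}} =
      (Fintype.card F ^ finrank F V - Fintype.card F ^ finrank F V₀) *
      ((Fintype.card F ^ (finrank F W₁ * finrank F V) -
        Fintype.card F ^ (finrank F W₁ * (finrank F V - 1))) *
      ∏ i : Fin (finrank F V - 1),
        (Fintype.card F ^ finrank F W₂ - Fintype.card F ^ (i : ℕ))) := by
  classical
  have : FiniteDimensional F W := e.symm.finiteDimensional
  have : Finite (V →ₗ[F] W) := Module.finite_of_finite F
  have : Finite V := Module.finite_of_finite F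
  have := Fintype.ofFinite (V →ₗ[F] W)
  have := Fintype.ofFinite V
  have hne : ∀ z ∉ V₀, z ≠ 0 := fun z hz h0 => hz (h0 ▸ zero_mem _)
  have hV₀ : (Finset.univ.filter fun z : V => z ∉ V₀).card =
      Fintype.card F ^ finrank F V - Fintype.card F ^ finrank F V₀ := by
    rw [← Fintype.card_subtype, Fintype.card_subtype_compl, ← Nat.card_eq_fintype_card (α := F),
      ← Module.natCard_eq_pow_finrank, ← Module.natCard_eq_pow_finrank, Nat.card_eq_fintype_card,
      Nat.card_eq_fintype_card]
  rw [Nat.card_eq_fintype_card, Fintype.card_subtype, mul_comm, eq_comm, ← hV₀]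
  refine Finset.card_mul_eq_card_mul (fun (z : V) (f : V →ₗ[F] W) =>
    LinearMap.ker ((LinearMap.snd F W₁ W₂ ∘ₗ e.toLinearMap) ∘ₗ f) = Submodule.span F {z}) ?_ ?_
  · intro z hz
    rw [Finset.mem_filter_univ] at hz
    rw [← natCard_linearMap_prod e (hne z hz) h, Nat.card_eq_fintype_card, Fintype.card_subtype]
    congr 1
    ext f
    simp only [Finset.mem_bipartiteAbove, Finset.mem_filter_univ]
    constructor
    · rintro ⟨⟨hf, -⟩, hk⟩
      exact ⟨hk, fun h0 => hne z hz (hf (by rw [h0, map_zero]))⟩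
    · rintro ⟨hk, hfz⟩
      refine ⟨⟨?_, z, hz, hk⟩, hk⟩
      rw [← LinearMap.ker_eq_bot, eq_bot_iff]
      intro x hx
      have hx' : x ∈ LinearMap.ker ((LinearMap.snd F W₁ W₂ ∘ₗ e.toLinearMap) ∘ₗ f) :=
        LinearMap.ker_le_ker_comp f _ hx
      rw [hk] at hx'
      obtain ⟨c, rfl⟩ := Submodule.mem_span_singleton.1 hx'
      rw [LinearMap.mem_ker, map_smul, smul_eq_zero] at hx
      rcases hx with rfl | hx
      · simp
      · exact absurd hx hfz
  · intro f hf
    rw [Finset.mem_filter_univ] at hf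
    obtain ⟨-, z₀, hz₀, hk⟩ := hf
    rw [← natCard_span_singleton_eq (F := F) (hne z₀ hz₀), Nat.card_eq_fintype_card,
      Fintype.card_subtype]
    congr 1
    ext z
    simp only [Finset.mem_bipartiteBelow, Finset.mem_filter_univ, hk]
    refine ⟨fun h => h.2, fun h => ⟨fun hz => hz₀ ?_, h⟩⟩
    have : z₀ ∈ Submodule.span F {z} := h ▸ Submodule.mem_span_singleton_self z₀
    exact (Submodule.span_singleton_le_iff_mem z V₀).2 hz this

end CountLinearMaps

section Frames

variable {p : ℕ} [Fact p.Prime] {N : ℕ}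

lemma isUnit_iff_isUnit_det_map {A : Matrix (Fin N) (Fin N) ℤ_[p]} :
    IsUnit A ↔ IsUnit (A.map PadicInt.toZMod).det := by
  rw [Matrix.isUnit_iff_isUnit_det, isUnit_iff_toZMod_ne_zero, isUnit_iff_ne_zero,
    RingHom.map_det]
  rfl

lemma exists_map_toZMod_eq {ι κ : Type*} (M : Matrix ι κ (ZMod p)) :
    ∃ X : Matrix ι κ ℤ_[p], X.map PadicInt.toZMod = M :=
  ⟨Matrix.of fun i => liftVec (M i), by ext i j; simp⟩

/-- The reduction modulo `p` of `A`, restricted to the subspace `V`. -/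
def frame (V : Submodule (ZMod p) (Fin N → ZMod p)) (A : Matrix (Fin N) (Fin N) ℤ_[p]) :
    V →ₗ[ZMod p] (Fin N → ZMod p) :=
  (A.map PadicInt.toZMod).mulVecLin ∘ₗ V.subtype

variable {V : Submodule (ZMod p) (Fin N → ZMod p)}

lemma frame_apply (A : Matrix (Fin N) (Fin N) ℤ_[p]) (z : V) :
    frame V A z = (A.map PadicInt.toZMod).mulVec z := rfl

lemma frame_mul (U A : Matrix (Fin N) (Fin N) ℤ_[p]) :
    frame V (U * A) = (U.map PadicInt.toZMod).mulVecLin ∘ₗ frame V A := by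
  ext1 z
  simp [frame_apply, Matrix.map_mul]

lemma mulVecLin_map_injective {U : Matrix (Fin N) (Fin N) ℤ_[p]} (hU : IsUnit U) :
    Function.Injective (U.map PadicInt.toZMod).mulVecLin := by
  have := isUnit_iff_isUnit_det_map.1 hU
  rw [← Matrix.isUnit_iff_isUnit_det] at this
  exact Matrix.mulVec_injective_of_isUnit this

lemma frame_injective {A : Matrix (Fin N) (Fin N) ℤ_[p]} (hA : IsUnit A) :
    Function.Injective (frame V A) :=
  (mulVecLin_map_injective hA).comp V.subtype_injective

lemma exists_unit_mulVecLin_comp_eq {f g : V →ₗ[ZMod p] (Fin N → ZMod p)}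
    (hf : Function.Injective f) (hg : Function.Injective g) :
    ∃ U : (Matrix (Fin N) (Fin N) ℤ_[p])ˣ,
      (U.val.map PadicInt.toZMod).mulVecLin ∘ₗ f = g := by
  obtain ⟨e, he⟩ := Submodule.exists_linearEquiv_restrict_eq
    ((LinearEquiv.ofInjective f hf).symm.trans (LinearEquiv.ofInjective g hg))
  obtain ⟨X, hX⟩ := exists_map_toZMod_eq (LinearMap.toMatrix' e.toLinearMap)
  have hXu : IsUnit X := by
    rw [isUnit_iff_isUnit_det_map, hX, LinearMap.det_toMatrix']
    exact e.isUnit_det'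
  refine ⟨hXu.unit, ?_⟩
  ext1 z
  have := he ⟨f z, LinearMap.mem_range_self f z⟩
  have h2 : (LinearEquiv.ofInjective f hf).symm ⟨f z, LinearMap.mem_range_self f z⟩ = z := by
    rw [LinearEquiv.symm_apply_eq]
    rfl
  rw [IsUnit.unit_spec, hX, LinearMap.comp_apply, Matrix.mulVecLin_apply,
    LinearMap.toMatrix'_mulVec]
  simp [h2] at this
  simpa using this.symm

/-- A unit congruent to `1` modulo `p` which moves `A x` by a prescribed amount modulo `p ^ 2`. -/
lemma exists_unit_shift {y : Fin N → ZMod p} (hy : y ≠ 0) (w : Fin N → ZMod p) :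
    ∃ U : (Matrix (Fin N) (Fin N) ℤ_[p])ˣ, U.val.map PadicInt.toZMod = 1 ∧
      ∀ x : Fin N → ℤ_[p], (∀ i, PadicInt.toZMod (x i) = y i) →
        ∀ i, (p : ℤ_[p]) ^ 2 ∣ U.val.mulVec x i - x i - p * liftVec w i := by
  obtain ⟨k, hk⟩ := Function.ne_iff.1 hy
  let X : Matrix (Fin N) (Fin N) ℤ_[p] :=
    Matrix.vecMulVec (liftVec w) (Pi.single k (liftVec y⁻¹ k))
  have hmap : (1 + (p : ℤ_[p]) • X).map PadicInt.toZMod = 1 := by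
    ext i j
    simp [Matrix.one_apply, apply_ite]
  have hu : IsUnit (1 + (p : ℤ_[p]) • X) := by
    rw [isUnit_iff_isUnit_det_map, hmap]
    simp
  refine ⟨hu.unit, hmap, fun x hx i => ?_⟩
  have hXx : X.mulVec x i = liftVec w i * (liftVec y⁻¹ k * x k) := by
    simp [X, Matrix.vecMulVec_mulVec, mul_comm]
  rw [IsUnit.unit_spec, Matrix.add_mulVec, Matrix.one_mulVec, Matrix.smul_mulVec, Pi.add_apply,
    Pi.smul_apply, add_sub_cancel_left, smul_eq_mul, ← mul_sub, pow_two, hXx]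
  refine mul_dvd_mul_left _ ?_
  rw [← toZMod_eq_zero_iff]
  have hk' : y k ≠ 0 := hk
  simp [hx, inv_mul_cancel₀ hk']

end Frames

section HaarFrames

variable {p : ℕ} [Fact p.Prime] {N : ℕ}

instance : BorelSpace ℤ_[p] := ⟨rfl⟩

lemma measurable_matrix_apply (i j : Fin N) :
    Measurable fun A : Matrix (Fin N) (Fin N) ℤ_[p] => A i j :=
  (measurable_pi_apply j).comp (measurable_pi_apply i)

lemma measurable_mulVec_apply (x : Fin N → ℤ_[p]) (i : Fin N) :
    Measurable fun A : Matrix (Fin N) (Fin N) ℤ_[p] => A.mulVec x i :=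
  Finset.measurable_sum Finset.univ fun j _ => (measurable_matrix_apply i j).mul_const (x j)

lemma measurable_mul_left (U : Matrix (Fin N) (Fin N) ℤ_[p]) :
    Measurable fun A : Matrix (Fin N) (Fin N) ℤ_[p] => U * A :=
  measurable_pi_lambda _ fun i => measurable_pi_lambda _ fun j =>
    Finset.measurable_sum Finset.univ fun k _ => (measurable_matrix_apply k j).const_mul (U i k)

lemma measurableSet_pow_dvd (k : ℕ) : MeasurableSet {x : ℤ_[p] | (p : ℤ_[p]) ^ k ∣ x} := by
  have : {x : ℤ_[p] | (p : ℤ_[p]) ^ k ∣ x} = {x | ‖x‖ ≤ (p : ℝ) ^ (-k : ℤ)} := by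
    ext x
    rw [Set.mem_ofPred_eq, Set.mem_ofPred_eq, PadicInt.norm_le_pow_iff_mem_span_pow,
      Ideal.mem_span_singleton]
  rw [this]
  exact (isClosed_le continuous_norm continuous_const).measurableSet

lemma measurableSet_map_toZMod (S : Set (Matrix (Fin N) (Fin N) (ZMod p))) :
    MeasurableSet {A : Matrix (Fin N) (Fin N) ℤ_[p] | A.map PadicInt.toZMod ∈ S} := by
  have : {A : Matrix (Fin N) (Fin N) ℤ_[p] | A.map PadicInt.toZMod ∈ S} =
      ⋃ M ∈ S, ⋂ i, ⋂ j, {A | (p : ℤ_[p]) ^ 1 ∣ A i j - liftVec (M i) j} := by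
    ext A
    simp only [Set.mem_ofPred_eq, Set.mem_iUnion, Set.mem_iInter, pow_one, ← toZMod_eq_zero_iff,
      map_sub, toZMod_liftVec, sub_eq_zero, exists_prop]
    refine ⟨fun h => ⟨_, h, fun i j => rfl⟩, ?_⟩
    rintro ⟨M, hM, h⟩
    have : A.map PadicInt.toZMod = M := by
      ext i j
      exact h i j
    rwa [this]
  rw [this]
  exact MeasurableSet.biUnion S.to_countable fun M _ => MeasurableSet.iInter fun i =>
    MeasurableSet.iInter fun j =>
      ((measurable_matrix_apply i j).sub_const _) (measurableSet_pow_dvd 1)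

variable {V : Submodule (ZMod p) (Fin N → ZMod p)}

lemma measurableSet_frame_eq (f : V →ₗ[ZMod p] (Fin N → ZMod p)) :
    MeasurableSet {A | frame V A = f} :=
  measurableSet_map_toZMod {B | B.mulVecLin ∘ₗ V.subtype = f}

variable {H : Measure (Matrix (Fin N) (Fin N) ℤ_[p])}

lemma measureReal_setOf_mul_mem
    (hH : ∀ U : (Matrix (Fin N) (Fin N) ℤ_[p])ˣ, Measure.map (fun M => U.val * M) H = H)
    (U : (Matrix (Fin N) (Fin N) ℤ_[p])ˣ) {S : Set (Matrix (Fin N) (Fin N) ℤ_[p])}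
    (hS : MeasurableSet S) : H.real {A | U.val * A ∈ S} = H.real S := by
  conv_rhs => rw [Measure.real, ← hH U, Measure.map_apply (measurable_mul_left _) hS]
  rfl

variable [IsProbabilityMeasure H]

lemma ae_isUnit (hHgl : H {M | IsUnit M.det} = 1) : ∀ᵐ A ∂H, IsUnit A := by
  have h : MeasurableSet {M : Matrix (Fin N) (Fin N) ℤ_[p] | IsUnit M.det} := by
    simp only [← Matrix.isUnit_iff_isUnit_det, isUnit_iff_isUnit_det_map]
    exact measurableSet_map_toZMod {B : Matrix (Fin N) (Fin N) (ZMod p) | IsUnit B}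
  rw [← prob_compl_eq_zero_iff h] at hHgl
  filter_upwards [measure_eq_zero_iff_ae_notMem.1 hHgl] with A hA
  rw [Matrix.isUnit_iff_isUnit_det]
  simpa using hA

lemma measureReal_iUnion_frame {P : (V →ₗ[ZMod p] (Fin N → ZMod p)) → Prop}
    {R : (V →ₗ[ZMod p] (Fin N → ZMod p)) → Set (Matrix (Fin N) (Fin N) ℤ_[p])}
    (hR : ∀ f, P f → MeasurableSet (R f)) (hRf : ∀ f, P f → ∀ A ∈ R f, frame V A = f) {c : ℝ}
    (hc : ∀ f, P f → H.real (R f) = c) :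
    H.real (⋃ f : {f // P f}, R f) = Nat.card {f // P f} * c := by
  classical
  have : Finite (V →ₗ[ZMod p] (Fin N → ZMod p)) := Module.finite_of_finite (ZMod p)
  have := Fintype.ofFinite {f : V →ₗ[ZMod p] (Fin N → ZMod p) // P f}
  have hdisj : Pairwise (Function.onFun Disjoint fun f : {f // P f} => R f) := by
    intro f g hfg
    refine Set.disjoint_left.2 fun A hA hA' => hfg (Subtype.ext ?_)
    rw [← hRf f f.2 A hA, hRf g g.2 A hA']
  rw [measureReal_iUnion_fintype hdisj fun f => hR f f.2,
    Finset.sum_congr rfl fun f _ => hc f.1 f.2, Finset.sum_const, Finset.card_univ,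
    Nat.card_eq_fintype_card, nsmul_eq_mul]

lemma natCard_mul_measureReal_frame_eq (hHgl : H {M | IsUnit M.det} = 1)
    (hH : ∀ U : (Matrix (Fin N) (Fin N) ℤ_[p])ˣ, Measure.map (fun M => U.val * M) H = H)
    {f : V →ₗ[ZMod p] (Fin N → ZMod p)} (hf : Function.Injective f) :
    Nat.card {g : V →ₗ[ZMod p] (Fin N → ZMod p) // Function.Injective g} *
      H.real {A | frame V A = f} = 1 := by
  rw [← measureReal_iUnion_frame (H := H) (P := fun g => Function.Injective g)
    (R := fun g => {A | frame V A = g}) (fun g _ => measurableSet_frame_eq g) (fun _ _ _ h => h)]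
  · rw [measureReal_congr (t := Set.univ), probReal_univ]
    rw [ae_eq_univ, ← compl_compl (⋃ _, _)]
    filter_upwards [ae_isUnit hHgl] with A hA
    simpa using frame_injective hA
  · intro g hg
    obtain ⟨U, hU⟩ := exists_unit_mulVecLin_comp_eq hf hg
    rw [← measureReal_setOf_mul_mem hH U (measurableSet_frame_eq g)]
    congr 1
    ext A
    simp only [Set.mem_ofPred_eq, frame_mul, ← hU]
    refine ⟨fun h => ?_, fun h => by rw [h]⟩
    ext1 x
    exact mulVecLin_map_injective U.isUnit (LinearMap.congr_fun h x)

end HaarFrames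

section SecondOrder

variable {p : ℕ} [Fact p.Prime] {N : ℕ} {V : Submodule (ZMod p) (Fin N → ZMod p)}
  {Q : Fin N → Prop}

/-- The matrices with frame `f` for which `A z` is congruent modulo `p ^ 2` to `p u` on the rows
satisfying `Q`, where `z` stands for its standard lift. -/
def frameSecondOrder (Q : Fin N → Prop) (f : V →ₗ[ZMod p] (Fin N → ZMod p)) (z : V)
    (u : {i // Q i} → ZMod p) : Set (Matrix (Fin N) (Fin N) ℤ_[p]) :=
  {A | frame V A = f ∧
    ∀ i : {i // Q i}, (p : ℤ_[p]) ^ 2 ∣ A.mulVec (liftVec (z : Fin N → ZMod p)) i - p * liftVec u i}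

lemma measurableSet_frameSecondOrder (f : V →ₗ[ZMod p] (Fin N → ZMod p)) (z : V)
    (u : {i // Q i} → ZMod p) : MeasurableSet (frameSecondOrder Q f z u) := by
  have : frameSecondOrder Q f z u = {A | frame V A = f} ∩ ⋂ i : {i // Q i},
      {A | (p : ℤ_[p]) ^ 2 ∣ A.mulVec (liftVec (z : Fin N → ZMod p)) i - p * liftVec u i} := by
    ext A
    simp [frameSecondOrder]
  rw [this]
  exact (measurableSet_frame_eq f).inter (MeasurableSet.iInter fun i =>
    ((measurable_mulVec_apply _ _).sub_const _) (measurableSet_pow_dvd 2))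

lemma toZMod_mulVec_liftVec {A : Matrix (Fin N) (Fin N) ℤ_[p]} (z : V) (i : Fin N) :
    PadicInt.toZMod (A.mulVec (liftVec (z : Fin N → ZMod p)) i) = frame V A z i := by
  rw [toZMod_mulVec]
  simp [frame_apply]

lemma sq_dvd_mul_iff {x : ℤ_[p]} : (p : ℤ_[p]) ^ 2 ∣ p * x ↔ PadicInt.toZMod x = 0 := by
  rw [pow_two, mul_dvd_mul_iff_left natCast_p_ne_zero, toZMod_eq_zero_iff]

lemma disjoint_frameSecondOrder (f : V →ₗ[ZMod p] (Fin N → ZMod p)) (z : V) :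
    Pairwise (Function.onFun Disjoint (frameSecondOrder Q f z)) := by
  intro u v huv
  refine Set.disjoint_left.2 fun A hA hA' => huv ?_
  ext i
  have h := dvd_sub (hA.2 i) (hA'.2 i)
  rw [sub_sub_sub_cancel_left, ← mul_sub, sq_dvd_mul_iff, map_sub, toZMod_liftVec,
    toZMod_liftVec, sub_eq_zero] at h
  exact h.symm

lemma iUnion_frameSecondOrder {f : V →ₗ[ZMod p] (Fin N → ZMod p)} {z : V}
    (hz : ∀ i, Q i → f z i = 0) : ⋃ u, frameSecondOrder Q f z u = {A | frame V A = f} := by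
  ext A
  simp only [Set.mem_iUnion]
  refine ⟨fun ⟨u, hu⟩ => hu.1, fun hA => ?_⟩
  have h : ∀ i : {i // Q i}, (p : ℤ_[p]) ∣ A.mulVec (liftVec (z : Fin N → ZMod p)) i := by
    intro i
    rw [← toZMod_eq_zero_iff, toZMod_mulVec_liftVec, show frame V A = f from hA]
    exact hz i i.2
  choose a ha using h
  refine ⟨fun i => PadicInt.toZMod (a i), hA, fun i => ?_⟩
  rw [ha i, ← mul_sub, sq_dvd_mul_iff]
  simp

variable {H : Measure (Matrix (Fin N) (Fin N) ℤ_[p])}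

lemma measureReal_frameSecondOrder_eq
    (hH : ∀ U : (Matrix (Fin N) (Fin N) ℤ_[p])ˣ, Measure.map (fun M => U.val * M) H = H)
    {f : V →ₗ[ZMod p] (Fin N → ZMod p)} {z : V} (hz : f z ≠ 0) (u v : {i // Q i} → ZMod p) :
    H.real (frameSecondOrder Q f z u) = H.real (frameSecondOrder Q f z v) := by
  classical
  let w : Fin N → ZMod p := fun i => if h : Q i then v ⟨i, h⟩ - u ⟨i, h⟩ else 0
  obtain ⟨U, hU, hUw⟩ := exists_unit_shift hz w
  have hfr : ∀ A, frame V (U.val * A) = frame V A := by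
    intro A
    ext1 x
    rw [frame_mul, hU]
    simp
  rw [← measureReal_setOf_mul_mem hH U (measurableSet_frameSecondOrder f z v)]
  congr 1
  ext A
  simp only [frameSecondOrder, Set.mem_ofPred_eq, hfr]
  refine and_congr_right fun hA => forall_congr' fun i => ?_
  have h1 := hUw (A.mulVec (liftVec (z : Fin N → ZMod p)))
    (fun j => by rw [toZMod_mulVec_liftVec, hA]) i
  have h2 : (p : ℤ_[p]) ^ 2 ∣ p * (liftVec w i - (liftVec v i - liftVec u i)) := by
    rw [sq_dvd_mul_iff]
    simp [w, i.2]
  rw [Matrix.mulVec_mulVec] at h1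
  rw [← dvd_add_left (dvd_add h1 h2)]
  ring_nf

lemma card_mul_measureReal_frameSecondOrder [IsProbabilityMeasure H]
    (hH : ∀ U : (Matrix (Fin N) (Fin N) ℤ_[p])ˣ, Measure.map (fun M => U.val * M) H = H)
    {f : V →ₗ[ZMod p] (Fin N → ZMod p)} {z : V} (hz : f z ≠ 0) (hz' : ∀ i, Q i → f z i = 0)
    (B : Finset ({i // Q i} → ZMod p)) :
    (Nat.card ({i // Q i} → ZMod p) : ℝ) * H.real (⋃ u ∈ B, frameSecondOrder Q f z u) =
      B.card * H.real {A | frame V A = f} := by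
  classical
  have := Fintype.ofFinite ({i // Q i} → ZMod p)
  rw [← iUnion_frameSecondOrder hz', measureReal_iUnion_fintype (disjoint_frameSecondOrder f z)
    (measurableSet_frameSecondOrder f z), measureReal_biUnion_finset
    ((disjoint_frameSecondOrder f z).set_pairwise _)
    fun u _ => measurableSet_frameSecondOrder f z u,
    Finset.sum_congr rfl fun u _ => measureReal_frameSecondOrder_eq hH hz u 0,
    Finset.sum_congr rfl fun u _ => measureReal_frameSecondOrder_eq hH hz u 0]
  rw [Finset.sum_const, Finset.sum_const, Finset.card_univ, Nat.card_eq_fintype_card,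
    nsmul_eq_mul, nsmul_eq_mul]
  ring

end SecondOrder

section GoodFrames

variable {p : ℕ} [Fact p.Prime] {N : ℕ} {V : Submodule (ZMod p) (Fin N → ZMod p)}
  {V₀ : Submodule (ZMod p) V} {Q : Fin N → Prop}

/-- Restriction of a vector to the coordinates satisfying `Q`. -/
def restrictRows (p : ℕ) [Fact p.Prime] {N : ℕ} (Q : Fin N → Prop) :
    (Fin N → ZMod p) →ₗ[ZMod p] ({i // Q i} → ZMod p) :=
  LinearMap.funLeft (ZMod p) (ZMod p) Subtype.val

@[simp] lemma restrictRows_apply (x : Fin N → ZMod p) (i : {i // Q i}) :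
    restrictRows p Q x i = x i := rfl

/-- An injective map whose composition with `restrictRows` has kernel a line outside `V₀`. -/
def GoodFrame (Q : Fin N → Prop) (V₀ : Submodule (ZMod p) V)
    (f : V →ₗ[ZMod p] (Fin N → ZMod p)) : Prop :=
  Function.Injective f ∧ ∃ z ∉ V₀, LinearMap.ker (restrictRows p Q ∘ₗ f) =
    Submodule.span (ZMod p) {z}

lemma natCard_goodFrame [DecidablePred Q]
    (h : Module.finrank (ZMod p) V ≤ (Finset.univ.filter Q).card + 1) :
    (p - 1) * Nat.card {f : V →ₗ[ZMod p] (Fin N → ZMod p) // GoodFrame Q V₀ f} =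
      (p ^ Module.finrank (ZMod p) V - p ^ Module.finrank (ZMod p) V₀) *
      ((p ^ ((Finset.univ.filter fun i => ¬ Q i).card * Module.finrank (ZMod p) V) -
        p ^ ((Finset.univ.filter fun i => ¬ Q i).card * (Module.finrank (ZMod p) V - 1))) *
      ∏ i : Fin (Module.finrank (ZMod p) V - 1),
        (p ^ (Finset.univ.filter Q).card - p ^ (i : ℕ))) := by
  let e : (Fin N → ZMod p) ≃ₗ[ZMod p] ({i // ¬ Q i} → ZMod p) × ({i // Q i} → ZMod p) :=
    LinearEquiv.funCongrLeft (ZMod p) (ZMod p)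
      ((Equiv.sumComm _ _).trans (Equiv.sumCompl Q)) ≪≫ₗ
        LinearEquiv.sumArrowLequivProdArrow _ _ (ZMod p) (ZMod p)
  have h1 : Module.finrank (ZMod p) ({i // Q i} → ZMod p) = (Finset.univ.filter Q).card := by
    rw [Module.finrank_fintype_fun_eq_card, Fintype.card_subtype]
  have h2 : Module.finrank (ZMod p) ({i // ¬ Q i} → ZMod p) =
      (Finset.univ.filter fun i => ¬ Q i).card := by
    rw [Module.finrank_fintype_fun_eq_card, Fintype.card_subtype]
  have := natCard_good_linearMap e V₀ (by rwa [h1])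
  rw [h1, h2, ZMod.card] at this
  exact this

variable {H : Measure (Matrix (Fin N) (Fin N) ℤ_[p])} [IsProbabilityMeasure H]

lemma natCard_mul_measureReal_le (hHgl : H {M | IsUnit M.det} = 1)
    (hH : ∀ U : (Matrix (Fin N) (Fin N) ℤ_[p])ˣ, Measure.map (fun M => U.val * M) H = H)
    {P : (V →ₗ[ZMod p] (Fin N → ZMod p)) → Prop} (hP : ∀ f, P f → Function.Injective f)
    {E : Set (Matrix (Fin N) (Fin N) ℤ_[p])} (hE : ∀ A ∈ E, IsUnit A → P (frame V A)) :
    Nat.card {f : V →ₗ[ZMod p] (Fin N → ZMod p) // Function.Injective f} * H.real E ≤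
      Nat.card {f // P f} := by
  have hle : H.real E ≤ H.real (⋃ f : {f // P f}, {A | frame V A = f}) := by
    refine ENNReal.toReal_mono (by finiteness) (measure_mono_ae ?_)
    filter_upwards [ae_isUnit hHgl] with A hA hAE
    exact Set.mem_iUnion.2 ⟨⟨_, hE A hAE hA⟩, rfl⟩
  rcases isEmpty_or_nonempty {f // P f} with hem | ⟨⟨f₀, hf₀⟩⟩
  · simp only [Set.iUnion_of_empty, measureReal_empty] at hle
    rw [le_antisymm hle measureReal_nonneg]
    simp
  · have hc : ∀ f, P f → H.real {A | frame V A = f} =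
        1 / Nat.card {f : V →ₗ[ZMod p] (Fin N → ZMod p) // Function.Injective f} :=
      fun f hf => eq_one_div_of_mul_eq_one_right
        (natCard_mul_measureReal_frame_eq hHgl hH (hP f hf))
    rw [measureReal_iUnion_frame (fun f _ => measurableSet_frame_eq f) (fun _ _ _ h => h) hc] at hle
    have hne := left_ne_zero_of_mul_eq_one
      (natCard_mul_measureReal_frame_eq hHgl hH (hP f₀ hf₀))
    refine (mul_le_mul_of_nonneg_left hle (Nat.cast_nonneg _)).trans_eq ?_
    field_simp

lemma le_natCard_mul_measureReal (hHgl : H {M | IsUnit M.det} = 1)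
    (hH : ∀ U : (Matrix (Fin N) (Fin N) ℤ_[p])ˣ, Measure.map (fun M => U.val * M) H = H)
    [DecidablePred Q] {E : Set (Matrix (Fin N) (Fin N) ℤ_[p])}
    (hE : ∀ f : V →ₗ[ZMod p] (Fin N → ZMod p), ∀ z ∉ V₀,
      LinearMap.ker (restrictRows p Q ∘ₗ f) = Submodule.span (ZMod p) {z} →
        ∀ u ∉ LinearMap.range (restrictRows p Q ∘ₗ f), frameSecondOrder Q f z u ⊆ E) :
    ((p : ℝ) ^ (Finset.univ.filter Q).card - p ^ (Module.finrank (ZMod p) V - 1)) *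
      Nat.card {f : V →ₗ[ZMod p] (Fin N → ZMod p) // GoodFrame Q V₀ f} ≤
    p ^ (Finset.univ.filter Q).card *
      (Nat.card {f : V →ₗ[ZMod p] (Fin N → ZMod p) // Function.Injective f} * H.real E) := by
  classical
  have hp : (0 : ℝ) < p := mod_cast (Fact.out : p.Prime).pos
  rcases isEmpty_or_nonempty {f : V →ₗ[ZMod p] (Fin N → ZMod p) // GoodFrame Q V₀ f} with
    hem | ⟨⟨f₀, hf₀⟩⟩
  · rw [Nat.card_of_isEmpty]
    simp only [Nat.cast_zero, mul_zero]
    positivity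
  have hz : ∀ f : V →ₗ[ZMod p] (Fin N → ZMod p), ∃ z, GoodFrame Q V₀ f → z ∉ V₀ ∧
      LinearMap.ker (restrictRows p Q ∘ₗ f) = Submodule.span (ZMod p) {z} := by
    intro f
    by_cases hf : GoodFrame Q V₀ f
    · obtain ⟨-, z, hz⟩ := hf
      exact ⟨z, fun _ => hz⟩
    · exact ⟨0, fun h => absurd h hf⟩
  choose z hz using hz
  let B (f : V →ₗ[ZMod p] (Fin N → ZMod p)) : Finset ({i // Q i} → ZMod p) :=
    Finset.univ.filter fun u => u ∉ LinearMap.range (restrictRows p Q ∘ₗ f)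
  have hB : ∀ f, GoodFrame Q V₀ f → ((B f).card : ℝ) =
      (p : ℝ) ^ (Finset.univ.filter Q).card - p ^ (Module.finrank (ZMod p) V - 1) := by
    intro f hf
    have hne : z f ≠ 0 := fun h => (hz f hf).1 (h ▸ zero_mem _)
    have hrk := LinearMap.finrank_range_add_finrank_ker (restrictRows p Q ∘ₗ f)
    rw [(hz f hf).2, finrank_span_singleton hne] at hrk
    have hcard := Finset.card_filter_add_card_filter_not (s := Finset.univ)
      fun u => u ∈ LinearMap.range (restrictRows p Q ∘ₗ f)
    rw [Finset.card_univ, ← Fintype.card_subtype, ← Nat.card_eq_fintype_card,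
      ← Nat.card_eq_fintype_card] at hcard
    have h1 := Module.natCard_eq_pow_finrank (K := ZMod p)
      (V := LinearMap.range (restrictRows p Q ∘ₗ f))
    have h2 := Module.natCard_eq_pow_finrank (K := ZMod p) (V := {i // Q i} → ZMod p)
    rw [Module.finrank_fintype_fun_eq_card, Fintype.card_subtype, Nat.card_zmod] at h2
    rw [Nat.card_zmod, Nat.eq_sub_of_add_eq hrk] at h1
    have h3 : (p : ℝ) ^ (Module.finrank (ZMod p) V - 1) + (B f).card =
        p ^ (Finset.univ.filter Q).card := by
      rw [← Nat.cast_pow, ← Nat.cast_pow, ← h1, ← h2, ← hcard, Nat.cast_add]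
    linarith
  have hqn : (p : ℝ) ^ (Finset.univ.filter Q).card ≠ 0 := by positivity
  have hcardne := left_ne_zero_of_mul_eq_one (natCard_mul_measureReal_frame_eq hHgl hH hf₀.1)
  have hc : ∀ f, GoodFrame Q V₀ f → H.real (⋃ u ∈ B f, frameSecondOrder Q f (z f) u) =
      ((p : ℝ) ^ (Finset.univ.filter Q).card - p ^ (Module.finrank (ZMod p) V - 1)) /
        (p ^ (Finset.univ.filter Q).card *
          Nat.card {f : V →ₗ[ZMod p] (Fin N → ZMod p) // Function.Injective f}) := by
    intro f hf
    have hfz : f (z f) ≠ 0 := fun h => (hz f hf).1 (hf.1 (h.trans (map_zero f).symm) ▸ zero_mem _)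
    have hfz' : ∀ i, Q i → f (z f) i = 0 := by
      intro i hi
      have hmem : z f ∈ LinearMap.ker (restrictRows p Q ∘ₗ f) :=
        (hz f hf).2 ▸ Submodule.mem_span_singleton_self (z f)
      exact congrFun hmem ⟨i, hi⟩
    have h1 := card_mul_measureReal_frameSecondOrder hH hfz hfz' (B f)
    have h2 := natCard_mul_measureReal_frame_eq hHgl hH hf.1
    rw [Module.natCard_eq_pow_finrank (K := ZMod p), Module.finrank_fintype_fun_eq_card,
      Fintype.card_subtype, Nat.card_zmod, Nat.cast_pow, hB f hf] at h1
    rw [eq_div_iff (mul_ne_zero hqn hcardne)]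
    linear_combination (Nat.card {f : V →ₗ[ZMod p] (Fin N → ZMod p) // Function.Injective f} : ℝ) *
      h1 + ((p : ℝ) ^ (Finset.univ.filter Q).card - p ^ (Module.finrank (ZMod p) V - 1)) * h2
  have hle : H.real (⋃ f : {f // GoodFrame Q V₀ f},
      ⋃ u ∈ B f, frameSecondOrder Q f.1 (z f) u) ≤ H.real E := by
    refine measureReal_mono (Set.iUnion_subset fun f => Set.iUnion₂_subset fun u hu => ?_)
    exact hE f _ (hz f f.2).1 (hz f f.2).2 u (Finset.mem_filter.1 hu).2
  rw [measureReal_iUnion_frame (R := fun f => ⋃ u ∈ B f, frameSecondOrder Q f (z f) u)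
    (fun f _ => Finset.measurableSet_biUnion _ fun u _ => measurableSet_frameSecondOrder f _ u)
    (fun f _ A hA => ?_) hc] at hle
  · refine Eq.trans_le ?_ (mul_le_mul_of_nonneg_left (mul_le_mul_of_nonneg_left hle
      (Nat.cast_nonneg _)) (by positivity))
    field_simp
  · obtain ⟨u, -, hu⟩ := Set.mem_iUnion₂.1 hA
    exact hu.1

end GoodFrames

section Pochhammer

variable {p : ℕ} [Fact p.Prime] {t : ℝ}

lemma tPoch_succ (t : ℝ) (n : ℕ) : tPoch t (n + 1) = tPoch t n * (1 - t ^ (n + 1)) :=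
  Finset.prod_range_succ _ n

lemma tPoch_pos (ht0 : 0 < t) (ht1 : t < 1) (n : ℕ) : 0 < tPoch t n :=
  Finset.prod_pos fun i _ => sub_pos.2 (pow_lt_one₀ ht0.le ht1 i.succ_ne_zero)

lemma pow_mul_pow_of_eq_one_div (ht : t = 1 / p) (n : ℕ) : (p : ℝ) ^ n * t ^ n = 1 := by
  rw [ht, ← mul_pow, mul_one_div_cancel (mod_cast (Fact.out : p.Prime).ne_zero), one_pow]

lemma pow_add_sub_pow (ht : t = 1 / p) (e n : ℕ) :
    (p : ℝ) ^ (e + n) - p ^ e = p ^ (e + n) * (1 - t ^ n) := by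
  rw [pow_add]
  linear_combination (p : ℝ) ^ e * pow_mul_pow_of_eq_one_div ht n

lemma prod_pow_sub_pow_mul_tPoch (ht : t = 1 / p) {k n : ℕ} (h : k ≤ n) :
    ((∏ i : Fin k, (p ^ n - p ^ (i : ℕ)) : ℕ) : ℝ) * tPoch t (n - k) =
      (p : ℝ) ^ (n * k) * tPoch t n := by
  induction k with
  | zero => simp
  | succ k ih =>
    specialize ih (by omega)
    obtain ⟨c, rfl⟩ : ∃ c, n = k + 1 + c := ⟨n - (k + 1), by omega⟩
    rw [show k + 1 + c - k = c + 1 by omega, tPoch_succ] at ih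
    have hc : (p : ℝ) ^ (k + 1 + c) - p ^ k = p ^ (k + 1 + c) * (1 - t ^ (c + 1)) := by
      rw [show k + 1 + c = k + (c + 1) by omega, pow_add_sub_pow ht]
    rw [Fin.prod_univ_castSucc, Nat.cast_mul, Fin.val_last,
      Nat.cast_sub (Nat.pow_le_pow_right (Fact.out : p.Prime).pos (by omega)),
      Nat.cast_pow, Nat.cast_pow, hc, show k + 1 + c - (k + 1) = c by omega]
    simp only [Fin.val_castSucc]
    linear_combination (p : ℝ) ^ (k + 1 + c) * ih

lemma natCast_good_eq (ht : t = 1 / p) {κ a ℓ m G I : ℕ} (ha : 1 ≤ a) (hm : m ≤ κ + 1)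
    (hG : (p - 1) * G = (p ^ (κ + 1) - p ^ (κ + 1 - m)) * ((p ^ (ℓ * (κ + 1)) - p ^ (ℓ * κ)) *
      ∏ i : Fin κ, (p ^ (κ + a) - p ^ (i : ℕ))))
    (hI : I = ∏ i : Fin (κ + 1), (p ^ (κ + a + ℓ) - p ^ (i : ℕ))) :
    (G : ℝ) = (t ^ a - t ^ (a + ℓ)) * ((1 - t ^ m) / (1 - t)) *
      (tPoch t (a + ℓ - 1) * tPoch t (κ + a)) / (tPoch t (κ + a + ℓ) * tPoch t a) * I := by
  have hp1 : (1 : ℝ) < p := mod_cast (Fact.out : p.Prime).one_lt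
  have hp : (p : ℝ) ≠ 0 := by positivity
  have ht0 : 0 < t := ht ▸ by positivity
  have ht1 : t < 1 := by rw [ht, div_lt_one (by positivity)]; exact hp1
  have hpos {e e' : ℕ} (h : e ≤ e') : p ^ e ≤ p ^ e' :=
    Nat.pow_le_pow_right (Fact.out : p.Prime).pos h
  have h1 := prod_pow_sub_pow_mul_tPoch (p := p) ht (Nat.le_add_right κ a)
  have h2 := prod_pow_sub_pow_mul_tPoch (p := p) ht (show κ + 1 ≤ κ + a + ℓ by omega)
  rw [← hI, show κ + a + ℓ - (κ + 1) = a + ℓ - 1 by omega] at h2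
  rw [Nat.add_sub_cancel_left] at h1
  have hG' := congrArg (Nat.cast (R := ℝ)) hG
  rw [Nat.cast_mul, Nat.cast_mul, Nat.cast_mul, Nat.cast_sub (Fact.out : p.Prime).one_le,
    Nat.cast_sub (hpos (by omega)), Nat.cast_sub (hpos (Nat.mul_le_mul_left _ (by omega)))]
    at hG'
  simp only [Nat.cast_pow, Nat.cast_one] at hG'
  have hk : (p : ℝ) ^ (κ + 1) - p ^ (κ + 1 - m) = p ^ (κ + 1) * (1 - t ^ m) := by
    obtain ⟨b, hb⟩ : ∃ b, κ + 1 = b + m := ⟨κ + 1 - m, by omega⟩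
    rw [hb, Nat.add_sub_cancel, pow_add_sub_pow ht]
  have hℓ : (p : ℝ) ^ (ℓ * (κ + 1)) - p ^ (ℓ * κ) = p ^ (ℓ * (κ + 1)) * (1 - t ^ ℓ) := by
    rw [mul_add_one, pow_add_sub_pow ht]
  have hq : (p : ℝ) - 1 = p * (1 - t) := by
    simpa using pow_add_sub_pow ht 0 1
  rw [hk, hℓ, hq] at hG'
  have hN := tPoch_pos ht0 ht1 (κ + a + ℓ)
  have hA := tPoch_pos ht0 ht1 a
  have hr := tPoch_pos ht0 ht1 (a + ℓ - 1)
  have h1t : 1 - t ≠ 0 := by linarith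
  generalize ((∏ i : Fin κ, (p ^ (κ + a) - p ^ (i : ℕ)) : ℕ) : ℝ) = X at h1 hG'
  have hX : X = (p : ℝ) ^ ((κ + a) * κ) * tPoch t (κ + a) / tPoch t a := by
    rw [eq_div_iff hA.ne', h1]
  have hI' : (I : ℝ) = (p : ℝ) ^ ((κ + a + ℓ) * (κ + 1)) * tPoch t (κ + a + ℓ) /
      tPoch t (a + ℓ - 1) := by
    rw [eq_div_iff hr.ne', h2]
  have hG'' : (G : ℝ) = p ^ (κ + 1) * (1 - t ^ m) * (p ^ (ℓ * (κ + 1)) * (1 - t ^ ℓ) * X) /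
      (p * (1 - t)) := by
    rw [eq_div_iff (mul_ne_zero hp h1t), ← hG']
    ring
  rw [hG'', hX, hI']
  have hta' : t ^ a - t ^ (a + ℓ) = (1 - t ^ ℓ) / p ^ a := by
    rw [eq_div_iff (pow_ne_zero _ hp), pow_add]
    linear_combination (1 - t ^ ℓ) * pow_mul_pow_of_eq_one_div ht a
  rw [hta']
  field_simp
  ring

end Pochhammer

section Corner

variable {p : ℕ} [Fact p.Prime] {N : ℕ} {A : Matrix (Fin N) (Fin N) ℤ_[p]}
  {lam mu : Fin N → WithTop ℕ} {P : Fin N → Prop}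

lemma cornerKer_map_toZMod :
    cornerKer (A.map PadicInt.toZMod) lam P = (LinearMap.ker (restrictRows p (fun i => lam i = 0) ∘ₗ
      frame (supportedOn (ZMod p) P) A)).map (supportedOn (ZMod p) P).subtype := by
  ext z
  rw [Submodule.mem_map]
  constructor
  · rintro ⟨hz, h⟩
    exact ⟨⟨z, hz⟩, funext fun i => h i i.2, rfl⟩
  · rintro ⟨z, hz, rfl⟩
    exact ⟨z.2, fun i hi => congrFun hz ⟨i, hi⟩⟩

lemma ker_frame_eq_span_iff {z : supportedOn (ZMod p) P} :
    LinearMap.ker (restrictRows p (fun i => lam i = 0) ∘ₗ frame (supportedOn (ZMod p) P) A) =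
        Submodule.span (ZMod p) {z} ↔
      cornerKer (A.map PadicInt.toZMod) lam P =
        Submodule.span (ZMod p) {(z : Fin N → ZMod p)} := by
  have : Submodule.span (ZMod p) {(z : Fin N → ZMod p)} =
      (Submodule.span (ZMod p) {z}).map (supportedOn (ZMod p) P).subtype := by
    rw [Submodule.map_span, Set.image_singleton, Submodule.subtype_apply]
  rw [cornerKer_map_toZMod, this]
  exact (Submodule.map_injective_of_injective (Submodule.subtype_injective _)).eq_iff.symm

lemma not_mem_comap_supportedOn_lt_iff {d : WithTop ℕ}
    {z : supportedOn (ZMod p) fun j => mu j ≤ d} :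
    z ∉ (supportedOn (ZMod p) fun j => mu j < d).comap (Submodule.subtype _) ↔
      ∃ j, mu j = d ∧ (z : Fin N → ZMod p) j ≠ 0 := by
  rw [Submodule.mem_comap, mem_supportedOn]
  push Not
  refine exists_congr fun j => ⟨fun ⟨h, hz⟩ => ⟨le_antisymm ?_ h, hz⟩, fun ⟨h, hz⟩ => ⟨h.ge, hz⟩⟩
  by_contra hj
  exact hz (z.2 j hj)

lemma exists_not_sq_dvd_mulVec {Q : Fin N → Prop}
    {f : supportedOn (ZMod p) P →ₗ[ZMod p] (Fin N → ZMod p)} {z : supportedOn (ZMod p) P}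
    {u : {i // Q i} → ZMod p} (hu : u ∉ LinearMap.range (restrictRows p Q ∘ₗ f))
    (hA : A ∈ frameSecondOrder Q f z u) {w : Fin N → ℤ_[p]}
    (hw : ∀ j, ¬ P j → (p : ℤ_[p]) ∣ w j) :
    ∃ i, Q i ∧ ¬ (p : ℤ_[p]) ^ 2 ∣
      A.mulVec (liftVec (z : Fin N → ZMod p) + (p : ℤ_[p]) • w) i := by
  by_contra! h
  refine hu ⟨-⟨fun j => PadicInt.toZMod (w j), fun j hj => toZMod_eq_zero_iff.2 (hw j hj)⟩, ?_⟩
  ext i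
  have h1 := dvd_sub (h i i.2) (hA.2 i)
  rw [Matrix.mulVec_add, Matrix.mulVec_smul, Pi.add_apply, Pi.smul_apply, add_sub_sub_cancel,
    smul_eq_mul, ← mul_add, sq_dvd_mul_iff, map_add, toZMod_liftVec, toZMod_mulVec] at h1
  rw [LinearMap.comp_apply, map_neg, map_neg, Pi.neg_apply, restrictRows_apply, ← hA.1,
    frame_apply]
  exact neg_eq_of_add_eq_zero_right h1

end Corner

theorem statement11 (p : ℕ) [Fact p.Prime] (t : ℝ) (ht : t = 1 / p)
    (N : ℕ) (hN : 1 ≤ N)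
    (lam mu : Fin N → WithTop ℕ) (hlam : Antitone lam) (hmu : Antitone mu)
    (H : Measure (Matrix (Fin N) (Fin N) ℤ_[p])) (hHprob : IsProbabilityMeasure H)
    (hHgl : H {M | IsUnit M.det} = 1)
    (hHinv : ∀ U : (Matrix (Fin N) (Fin N) ℤ_[p])ˣ,
      Measure.map (fun M => U.val * M) H = H)
    (ℓ : ℕ) (hℓ : ℓ = (Finset.univ.filter fun i : Fin N => 1 ≤ lam i).card)
    (r : ℕ) (hr1 : ℓ + 1 ≤ r) (hrN : r ≤ N)
    (hmur : (r = 1 ∧ mu ⟨0, by omega⟩ < ⊤) ∨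
            (2 ≤ r ∧ mu ⟨r - 1, by omega⟩ < mu ⟨r - 2, by omega⟩))
    (m : ℕ) (hm : m = (Finset.univ.filter fun j : Fin N => mu j = mu ⟨r - 1, by omega⟩).card)
    (C : ℝ) (hC : C = (t ^ (r - ℓ) - t ^ r) * ((1 - t ^ m) / (1 - t)) *
      (tPoch t (r - 1) * tPoch t (N - ℓ)) / (tPoch t N * tPoch t (r - ℓ)))
    (E : Set (Matrix (Fin N) (Fin N) ℤ_[p]))
    (hE : E = {M | ∃ s : Fin N → WithTop ℕ,
      IsSN p N (snDiag p N lam * M * snDiag p N mu) s ∧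
        s ⟨r - 1, by omega⟩ = mu ⟨r - 1, by omega⟩ + 1 ∧
        ∀ j : Fin N, r ≤ (j : ℕ) → s j = mu j}) :
    (1 - t ^ (r - ℓ)) * C ≤ (H E).toReal ∧ (H E).toReal ≤ C := by
  have hρN : r - 1 < N := by omega
  let ρ : Fin N := ⟨r - 1, hρN⟩
  obtain ⟨d, hd, hJ⟩ : ∃ d : ℕ, mu ρ = d ∧ ∀ j, mu j ≤ d ↔ ρ ≤ j := by
    have hlt : mu ρ < ⊤ := by
      rcases hmur with ⟨rfl, h⟩ | ⟨-, h⟩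
      · exact h
      · exact h.trans_le le_top
    obtain h | ⟨d, hd⟩ := eq_top_or_eq_natCast (mu ρ)
    · exact absurd h hlt.ne
    refine ⟨d, hd, fun j => ⟨fun hj => ?_, fun hj => hd ▸ hmu hj⟩⟩
    by_contra hlt'
    rw [Fin.le_def] at hlt'
    rcases hmur with ⟨rfl, h⟩ | ⟨hr2, h⟩
    · exact hlt' (Nat.zero_le _)
    · have hj2 : j ≤ ⟨r - 2, by omega⟩ := by
        rw [Fin.le_def]
        simp only [ρ] at hlt' ⊢
        omega
      exact absurd ((hmu hj2).trans (hj.trans hd.ge)) (not_le.2 h)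
  have hk : (Finset.univ.filter fun j => mu j ≤ d).card = N - r + 1 := by
    simp only [hJ]
    rw [Finset.filter_le_eq_Ici, Fin.card_Ici]
    simp only [ρ]
    omega
  have hkm : (Finset.univ.filter fun j => mu j < d).card + m = N - r + 1 := by
    rw [← hk, hm, ← Finset.card_union_of_disjoint, ← Finset.filter_or]
    · congr 1
      ext j
      simp only [Finset.mem_filter_univ]
      rw [show mu ⟨r - 1, hρN⟩ = d from hd, le_iff_lt_or_eq]
    · rw [Finset.disjoint_filter]
      intro j _ h h'
      exact h.ne (h'.trans hd)
  have hℓ' : (Finset.univ.filter fun i => ¬ lam i = 0).card = ℓ := by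
    rw [hℓ]
    congr 1
    ext i
    rw [Finset.mem_filter_univ, Finset.mem_filter_univ]
    exact (Order.one_le_iff_ne_zero (α := ℕ∞) (x := lam i)).symm
  have hn : (Finset.univ.filter fun i => lam i = 0).card = N - ℓ := by
    have := Finset.card_filter_add_card_filter_not (s := Finset.univ) fun i : Fin N => lam i = 0
    rw [hℓ', Finset.card_univ, Fintype.card_fin] at this
    omega
  let V := supportedOn (ZMod p) fun j => mu j ≤ d
  let V₀ : Submodule (ZMod p) V := (supportedOn (ZMod p) fun j => mu j < d).comap V.subtype
  have hV : Module.finrank (ZMod p) V = N - r + 1 := by rw [finrank_supportedOn, hk]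
  have hV₀ : Module.finrank (ZMod p) V₀ = N - r + 1 - m := by
    rw [(Submodule.comapSubtypeEquivOfLe (supportedOn_mono fun j hj => hj.le)).finrank_eq,
      finrank_supportedOn]
    omega
  have hlow := le_natCard_mul_measureReal (V₀ := V₀) (Q := fun i => lam i = 0) (E := E) hHgl hHinv
    fun f z hz hker u hu A hA => by
      rw [hE]
      obtain ⟨s, hs, hsρ, hgt⟩ := exists_isSN_of_cornerKer_eq_span hmu hd hJ
        (not_mem_comap_supportedOn_lt_iff.1 hz) (ker_frame_eq_span_iff.1 (hA.1 ▸ hker))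
        fun w hw => exists_not_sq_dvd_mulVec hu hA hw
      refine ⟨s, hs, hsρ, fun j hj => hgt j ?_⟩
      rw [Fin.lt_def]
      simp only [ρ]
      omega
  have hup := natCard_mul_measureReal_le (V := V) (E := E)
    (P := GoodFrame (fun i => lam i = 0) V₀) hHgl hHinv (fun f hf => hf.1) fun A hA hAu => by
      rw [hE] at hA
      obtain ⟨s, hs, hsρ, hgt⟩ := hA
      obtain ⟨z, hz, hspan⟩ := exists_cornerKer_eq_span_of_isSN hs hd hJ hsρ fun j hj => hgt j (by
        rw [Fin.lt_def] at hj
        simp only [ρ] at hj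
        omega)
      have hzV : z ∈ V := by
        have : z ∈ cornerKer (A.map PadicInt.toZMod) lam (fun j => mu j ≤ d) :=
          hspan ▸ Submodule.mem_span_singleton_self z
        exact this.1
      exact ⟨frame_injective hAu, ⟨z, hzV⟩, not_mem_comap_supportedOn_lt_iff.2 hz,
        ker_frame_eq_span_iff.2 hspan⟩
  have hG := natCard_goodFrame (V₀ := V₀) (Q := fun i => lam i = 0) (by rw [hV, hn]; omega)
  have hI := natCard_injective_linearMap (F := ZMod p) (V := V) (W := Fin N → ZMod p) (by
    rw [hV, Module.finrank_fin_fun]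
    omega)
  rw [hV, hV₀, hℓ', hn, Nat.add_sub_cancel] at hG
  rw [Module.finrank_fin_fun, ZMod.card, hV] at hI
  rw [hV, hn, Nat.add_sub_cancel] at hlow
  have hGC := natCast_good_eq ht (κ := N - r) (a := r - ℓ) (ℓ := ℓ) (m := m)
    (I := Nat.card {f : V →ₗ[ZMod p] (Fin N → ZMod p) // Function.Injective f})
    (by omega) (by omega)
    (by rwa [show N - r + (r - ℓ) = N - ℓ by omega])
    (by rwa [show N - r + (r - ℓ) + ℓ = N by omega])
  rw [show N - r + (r - ℓ) + ℓ = N by omega, show N - r + (r - ℓ) = N - ℓ by omega,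
    show r - ℓ + ℓ = r by omega, ← hC] at hGC
  have hp : (0 : ℝ) < p := mod_cast (Fact.out : p.Prime).pos
  have hIpos : (0 : ℝ) <
      Nat.card {f : V →ₗ[ZMod p] (Fin N → ZMod p) // Function.Injective f} := by
    have : Nonempty {f : V →ₗ[ZMod p] (Fin N → ZMod p) // Function.Injective f} :=
      ⟨⟨V.subtype, V.subtype_injective⟩⟩
    have : Finite (V →ₗ[ZMod p] (Fin N → ZMod p)) := Module.finite_of_finite (ZMod p)
    exact mod_cast Nat.card_pos
  have hpow := pow_add_sub_pow ht (N - r) (r - ℓ)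
  rw [show N - r + (r - ℓ) = N - ℓ by omega] at hpow
  rw [hGC] at hup hlow
  rw [hpow, mul_assoc] at hlow
  replace hlow := le_of_mul_le_mul_left hlow (pow_pos hp _)
  rw [← mul_assoc, mul_comm] at hlow
  rw [mul_comm C] at hup
  exact ⟨le_of_mul_le_mul_left hlow hIpos, le_of_mul_le_mul_left hup hIpos⟩
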